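/- arXiv:0705.3383 — 2 statements merged into one kernel-verified Lean document; each statement's English description precedes it below -/
import Mathlib

section
/- Let r₀ ≥ 2 be an integer. Assume that f̃_t is a C^{r₀,r₀} perturbation of a piecewise expanding C^{r₀} unimodal map f, and that for each small t there exists a homeomorphism h_t of I with h_t(c) = c and f̃_t = h_t ∘ f ∘ h_t^{-1}. Then for small enough ε > 0, the map (t,x) ↦ h_t(x) is continuous from (−ε,ε) × I to ℝ, and the maps t ↦ h_t(x) are C^{r₀−1+Lip} on [−ε,ε] uniformly in x ∈ I, i.e. sup_{x ∈ I} ‖h_·(x)‖_{C^{r₀−1+Lip}([−ε,ε])} < ∞. -/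
open Set MeasureTheory Filter Topology

noncomputable section

/-- A piecewise expanding `C^r` unimodal map on `I = [a,b]` with critical (turning) point `c`:
`f` is continuous on `I`, strictly increasing on `[a,c]`, strictly decreasing on `[c,b]`,
`f(a) = f(b) = a`, and on each side the map extends to a `C^r` map (`fp`, resp. `fm`) on an
open neighbourhood (`Up`, resp. `Um`) with derivative bounded below in modulus by some `κ > 1`. -/
structure PWUnimodal (r : ℕ) where
  a : ℝ
  b : ℝ
  c : ℝ
  hac : a < c
  hcb : c < b
  f : ℝ → ℝ
  cont : ContinuousOn f (Set.Icc a b)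
  mapsI : Set.MapsTo f (Set.Icc a b) (Set.Icc a b)
  mono : StrictMonoOn f (Set.Icc a c)
  anti : StrictAntiOn f (Set.Icc c b)
  fa : f a = a
  fb : f b = a
  Up : Set ℝ
  Um : Set ℝ
  openUp : IsOpen Up
  openUm : IsOpen Um
  subUp : Set.Icc a c ⊆ Up
  subUm : Set.Icc c b ⊆ Um
  fp : ℝ → ℝ
  fm : ℝ → ℝ
  fp_eq : Set.EqOn fp f (Set.Icc a c)
  fm_eq : Set.EqOn fm f (Set.Icc c b)
  fp_smooth : ContDiffOn ℝ r fp Up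
  fm_smooth : ContDiffOn ℝ r fm Um
  κ : ℝ
  one_lt_κ : 1 < κ
  fp_exp : ∀ x ∈ Up, κ ≤ |deriv fp x|
  fm_exp : ∀ x ∈ Um, κ ≤ |deriv fm x|

namespace PWUnimodal

variable {r : ℕ}

/-- The (one-sided) derivative `f'` of a piecewise expanding unimodal map, defined via the
two smooth extensions. -/
def d (F : PWUnimodal r) (x : ℝ) : ℝ := if x ≤ F.c then deriv F.fp x else deriv F.fm x

/-- `(f^n)'(x)`, the derivative of the `n`-th iterate. -/
def dn (F : PWUnimodal r) (n : ℕ) (x : ℝ) : ℝ :=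
  ∏ i ∈ Finset.range n, F.d (F.f^[i] x)

/-- `c_k = f^k(c)`, the postcritical orbit. -/
def ck (F : PWUnimodal r) (k : ℕ) : ℝ := F.f^[k] F.c

/-- The critical point is periodic. -/
def CritPeriodic (F : PWUnimodal r) : Prop := ∃ n, 0 < n ∧ F.f^[n] F.c = F.c

/-- `f` is good: either `c` is not periodic, or `inf |(f^{n₁})'| > 2` where `n₁` is the
minimal period of `c`. -/
def Good (F : PWUnimodal r) : Prop :=
  ¬ F.CritPeriodic ∨
    ∀ x ∈ Set.Icc F.a F.b, 2 < |F.dn (Function.minimalPeriod F.f F.c) x|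

/-- `f` is topologically mixing on `[f²(c), f(c)]`. -/
def Mixing (F : PWUnimodal r) : Prop :=
  ∀ U V : Set ℝ, IsOpen U → IsOpen V →
    (U ∩ Set.Icc (F.ck 2) (F.ck 1)).Nonempty →
    (V ∩ Set.Icc (F.ck 2) (F.ck 1)).Nonempty →
    ∃ N, ∀ n ≥ N, (F.f^[n] '' (U ∩ Set.Icc (F.ck 2) (F.ck 1)) ∩ V).Nonempty

/-- `v` is horizontal for `f`: `∑_{j=0}^{M_f-1} v(c_j)/(f^j)'(c_1) = 0`, where `M_f = n₁` if
`c` is periodic of minimal period `n₁` and `M_f = ∞` otherwise. -/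
def Horizontal (F : PWUnimodal r) (v : ℝ → ℝ) : Prop :=
  (F.CritPeriodic →
    ∑ j ∈ Finset.range (Function.minimalPeriod F.f F.c), v (F.ck j) / F.dn j (F.ck 1) = 0) ∧
  (¬ F.CritPeriodic → ∑' j : ℕ, v (F.ck j) / F.dn j (F.ck 1) = 0)

open scoped Classical in
/-- `N_f = n₀ + n₁ - 1` if `c` is preperiodic, `n₁` if `c` is periodic of minimal period `n₁`,
and `∞` otherwise. -/
def Nf (F : PWUnimodal r) : ℕ∞ :=
  if F.c ∈ Function.periodicPts F.f then (Function.minimalPeriod F.f F.c : ℕ∞)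
  else if h : ∃ m, 0 < m ∧ F.f^[m] F.c ∈ Function.periodicPts F.f then
    ((Nat.find h + Function.minimalPeriod F.f (F.f^[Nat.find h] F.c) - 1 : ℕ) : ℕ∞)
  else ⊤

open scoped Classical in
/-- `M_f = n₁` if `c` is periodic of minimal period `n₁`, and `∞` otherwise. -/
def Mf (F : PWUnimodal r) : ℕ∞ :=
  if F.c ∈ Function.periodicPts F.f then (Function.minimalPeriod F.f F.c : ℕ∞) else ⊤

/-- `ρ` is the (unique) absolutely continuous invariant probability density of `f`:
a nonnegative integrable function of bounded variation, supported in `[a,b]`, of total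
integral one, whose associated measure is `f`-invariant. -/
structure IsInvDensity (F : PWUnimodal r) (ρ : ℝ → ℝ) : Prop where
  nonneg : ∀ x, 0 ≤ ρ x
  integrable : MeasureTheory.Integrable ρ
  mass : (∫ x, ρ x) = 1
  supp : Function.support ρ ⊆ Set.Icc F.a F.b
  bv : BoundedVariationOn ρ Set.univ
  invariant : ∀ φ : ℝ → ℝ, Continuous φ → (∫ x, φ (F.f x) * ρ x) = ∫ x, φ x * ρ x

end PWUnimodal

/-- Sum of `g n` over `1 ≤ n ≤ N`, where `N ∈ ℕ∞`. -/
def sumTo (N : ℕ∞) (g : ℕ → ℝ) : ℝ :=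
  ∑' n : ℕ, if 1 ≤ n ∧ (n : ℕ∞) ≤ N then g n else 0

/-- The jump function `H_u`: `-1` on `(-∞,u)`, `-1/2` at `u`, `0` on `(u,∞)`. -/
def Hfun (u x : ℝ) : ℝ := if x < u then -1 else if x = u then -(1/2) else 0

namespace PWUnimodal

variable {r : ℕ}

/-- The saltus function `∑_{n=1}^{N_f} s_n H_{c_n}`. -/
def saltus (F : PWUnimodal r) (s : ℕ → ℝ) (x : ℝ) : ℝ :=
  sumTo F.Nf (fun n => s n * Hfun (F.ck n) x)

/-- The decomposition `ρ₀ = ρ_reg + ρ_sal` of the invariant density into a continuous part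
and the saltus part `ρ_sal = ∑_{n=1}^{N_f} s_n H_{c_n}`. -/
structure SaltusDecomp (F : PWUnimodal r) (ρ₀ ρreg : ℝ → ℝ) (s : ℕ → ℝ) : Prop where
  cont : Continuous ρreg
  eq : ∀ x, ρ₀ x = ρreg x + F.saltus s x

/-- The weighted total jump `J(f,X) = ∑_{n=1}^{N_f} s_n X(c_n)`. -/
def Jfun (F : PWUnimodal r) (s : ℕ → ℝ) (X : ℝ → ℝ) : ℝ :=
  sumTo F.Nf (fun n => s n * X (F.ck n))

open scoped Classical in
/-- The solution `α_{(0)}` (with `α(c) = 0`) of the twisted cohomological equation, given by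
the explicit series/finite-sum formula. -/
def alpha0 (F : PWUnimodal r) (v : ℝ → ℝ) (x : ℝ) : ℝ :=
  if h : ∃ ℓ, 1 ≤ ℓ ∧ F.f^[ℓ] x = F.c then
    -∑ j ∈ Finset.range (Nat.find h), v (F.f^[j] x) / F.dn (j+1) x
  else -∑' j : ℕ, v (F.f^[j] x) / F.dn (j+1) x

/-- `C^r` extensions `ψ₊, ψ₋` of the two inverse branches of `f` to `J = (-∞, f(c)]`,
with derivatives bounded in modulus by some `θ < 1`. -/
structure InvBranches (F : PWUnimodal r) where
  ψp : ℝ → ℝ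
  ψm : ℝ → ℝ
  smooth_p : ContDiffOn ℝ r ψp (Set.Iic (F.f F.c))
  smooth_m : ContDiffOn ℝ r ψm (Set.Iic (F.f F.c))
  inv_p : ∀ y ∈ Set.Icc F.a (F.f F.c), ψp y ∈ Set.Icc F.a F.c ∧ F.f (ψp y) = y
  inv_m : ∀ y ∈ Set.Icc F.a (F.f F.c), ψm y ∈ Set.Icc F.c F.b ∧ F.f (ψm y) = y
  θ : ℝ
  θ_lt : θ < 1
  dψp : ∀ y ∈ Set.Iic (F.f F.c), |deriv ψp y| ≤ θ
  dψm : ∀ y ∈ Set.Iic (F.f F.c), |deriv ψm y| ≤ θ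

/-- `χ`: the indicator `1` on `(-∞, f(c))`, `1/2` at `f(c)`, `0` beyond. -/
def χ (F : PWUnimodal r) (x : ℝ) : ℝ :=
  if x < F.f F.c then 1 else if x = F.f F.c then 1/2 else 0

/-- The operator `L₀`. -/
def InvBranches.L0 {F : PWUnimodal r} (B : F.InvBranches) (φ : ℝ → ℝ) (x : ℝ) : ℝ :=
  F.χ x * φ (B.ψp x) - F.χ x * φ (B.ψm x)

/-- The Perron-Frobenius transfer operator `L₁`. -/
def InvBranches.L1 {F : PWUnimodal r} (B : F.InvBranches) (φ : ℝ → ℝ) (x : ℝ) : ℝ :=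
  F.χ x * (deriv B.ψp x * φ (B.ψp x)) + F.χ x * (|deriv B.ψm x| * φ (B.ψm x))

/-- The operator `L₀` on complex-valued functions. -/
def InvBranches.L0c {F : PWUnimodal r} (B : F.InvBranches) (φ : ℝ → ℂ) (x : ℝ) : ℂ :=
  (F.χ x : ℂ) * φ (B.ψp x) - (F.χ x : ℂ) * φ (B.ψm x)

/-- The transfer operator `L₁` on complex-valued functions. -/
def InvBranches.L1c {F : PWUnimodal r} (B : F.InvBranches) (φ : ℝ → ℂ) (x : ℝ) : ℂ :=
  (F.χ x : ℂ) * (Complex.ofReal (deriv B.ψp x) * φ (B.ψp x)) +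
    (F.χ x : ℂ) * (Complex.ofReal |deriv B.ψm x| * φ (B.ψm x))

/-- Forgetting smoothness: a piecewise expanding `C^r` unimodal map is also `C^{r'}` for
`r' ≤ r`. -/
def restrict (F : PWUnimodal r) (r' : ℕ) (h : r' ≤ r) : PWUnimodal r' :=
  { F with
    fp_smooth := F.fp_smooth.of_le (by exact_mod_cast h)
    fm_smooth := F.fm_smooth.of_le (by exact_mod_cast h) }

end PWUnimodal

/-- A `C^{r₀,r}` perturbation `(f_t)_{|t|<ε}` of a piecewise expanding `C^r` unimodal map `F`:
a family of piecewise expanding `C^r` unimodal maps on the same interval with the same turning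
point, with `f_0 = f`, uniformly bounded `C^r` norms of the one-sided extensions on fixed
neighbourhoods, `‖(f - f_t)|_{I_σ}‖_{C^{r-1}} = O(t)`, and such that `(x,t) ↦ f_t(x)` extends,
on each side, to a `C^{r₀}` function on a neighbourhood of `I_σ × {0}`. -/
structure PWFamily (r₀ r : ℕ) (F : PWUnimodal r) (ε : ℝ) where
  εpos : 0 < ε
  fam : ℝ → PWUnimodal r
  same_a : ∀ t, (fam t).a = F.a
  same_b : ∀ t, (fam t).b = F.b
  same_c : ∀ t, (fam t).c = F.c
  at0 : fam 0 = F
  Vp : Set ℝ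
  Vm : Set ℝ
  openVp : IsOpen Vp
  openVm : IsOpen Vm
  subVp : Set.Icc F.a F.c ⊆ Vp
  subVm : Set.Icc F.c F.b ⊆ Vm
  VpUp : ∀ t, |t| < ε → Vp ⊆ (fam t).Up
  VmUm : ∀ t, |t| < ε → Vm ⊆ (fam t).Um
  Cb : ℝ
  unif_p : ∀ t, |t| < ε → ∀ i ≤ r, ∀ x ∈ Vp, |iteratedDeriv i (fam t).fp x| ≤ Cb
  unif_m : ∀ t, |t| < ε → ∀ i ≤ r, ∀ x ∈ Vm, |iteratedDeriv i (fam t).fm x| ≤ Cb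
  close_p : ∀ t, |t| < ε → ∀ i ≤ r - 1, ∀ x ∈ Vp,
    |iteratedDeriv i (fun y => F.fp y - (fam t).fp y) x| ≤ Cb * |t|
  close_m : ∀ t, |t| < ε → ∀ i ≤ r - 1, ∀ x ∈ Vm,
    |iteratedDeriv i (fun y => F.fm y - (fam t).fm y) x| ≤ Cb * |t|
  Gp : ℝ × ℝ → ℝ
  Gm : ℝ × ℝ → ℝ
  Wp : Set (ℝ × ℝ)
  Wm : Set (ℝ × ℝ)
  openWp : IsOpen Wp
  openWm : IsOpen Wm
  subWp : (Set.Icc F.a F.c) ×ˢ ({0} : Set ℝ) ⊆ Wp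
  subWm : (Set.Icc F.c F.b) ×ˢ ({0} : Set ℝ) ⊆ Wm
  smoothGp : ContDiffOn ℝ r₀ Gp Wp
  smoothGm : ContDiffOn ℝ r₀ Gm Wm
  Gp_eq : ∀ t, |t| < ε → ∀ x ∈ Set.Icc F.a F.c, (x, t) ∈ Wp → Gp (x, t) = (fam t).f x
  Gm_eq : ∀ t, |t| < ε → ∀ x ∈ Set.Icc F.c F.b, (x, t) ∈ Wm → Gm (x, t) = (fam t).f x

/-- The infinitesimal deformation `v = ∂_t f_t|_{t=0}`. -/
def PWFamily.v {r₀ r : ℕ} {F : PWUnimodal r} {ε : ℝ} (P : PWFamily r₀ r F ε) (x : ℝ) : ℝ :=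
  if x ≤ F.c then deriv (fun t => P.Gp (x, t)) 0 else deriv (fun t => P.Gm (x, t)) 0

/-- A `C^{r₀,r}` perturbation staying in the topological class of `F`: each `f_t` is
conjugated to `f` by a homeomorphism `h_t` of `I` fixing `c`. -/
structure ConjFamily (r₀ r : ℕ) (F : PWUnimodal r) (ε : ℝ) extends PWFamily r₀ r F ε where
  h : ℝ → ℝ → ℝ
  h_cont : ∀ t, |t| < ε → ContinuousOn (h t) (Set.Icc F.a F.b)
  h_bij : ∀ t, |t| < ε → Set.BijOn (h t) (Set.Icc F.a F.b) (Set.Icc F.a F.b)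
  h_c : ∀ t, |t| < ε → h t F.c = F.c
  h_conj : ∀ t, |t| < ε → ∀ x ∈ Set.Icc F.a F.b, (fam t).f (h t x) = h t (F.f x)

/-- The infinitesimal conjugacy `α = ∂_t h_t|_{t=0}`. -/
def ConjFamily.alpha {r₀ r : ℕ} {F : PWUnimodal r} {ε : ℝ} (C : ConjFamily r₀ r F ε)
    (x : ℝ) : ℝ :=
  deriv (fun t => C.h t x) 0

/-- A perturbation `P` is tangent to the topological class of `F` if there is a `C^{2,2}`
perturbation `f̃_t` of `F` lying in the topological class of `F` with
`sup_x |f̃_t(x) - f_t(x)| = O(t²)`. -/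
structure PWFamily.TangentData {r₀ r : ℕ} {F : PWUnimodal r} {ε : ℝ}
    (P : PWFamily r₀ r F ε) (hr : 2 ≤ r) where
  Q : ConjFamily 2 2 (F.restrict 2 hr) ε
  K : ℝ
  close : ∀ t, |t| < ε → ∀ x ∈ Set.Icc F.a F.b, |(Q.fam t).f x - (P.fam t).f x| ≤ K * t ^ 2

/-- An abstract realization of the Banach space `BV` of bounded variation functions supported
in `[a,b]`, modulo functions differing on an at most countable set, with the variation norm. -/
structure BVRealization (a b : ℝ) (V : Type) [NormedAddCommGroup V] [NormedSpace ℂ V] where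
  toFun : V →ₗ[ℂ] (ℝ → ℂ)
  bv : ∀ φ, BoundedVariationOn (toFun φ) Set.univ
  supp : ∀ φ, Function.support (toFun φ) ⊆ Set.Icc a b
  zero_iff : ∀ φ : V, φ = 0 ↔ (Function.support (toFun φ)).Countable
  surj : ∀ g : ℝ → ℂ, BoundedVariationOn g Set.univ → Function.support g ⊆ Set.Icc a b →
    ∃ φ : V, {x | toFun φ x ≠ g x}.Countable
  norm_eq : ∀ φ : V, ENNReal.ofReal ‖φ‖ =
    ⨅ g ∈ {g : ℝ → ℂ | {x | g x ≠ toFun φ x}.Countable}, eVariationOn g Set.univ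

/-- An abstract realization of the Banach space `BV^{(1)}` of functions supported in
`(-∞, b]` whose (distributional) derivative is a function of bounded variation, with norm
`‖φ‖ = ‖φ'‖_{BV}`. -/
structure BV1Realization (a b : ℝ) (W : Type) [NormedAddCommGroup W] [NormedSpace ℂ W] where
  toFun : W →ₗ[ℂ] (ℝ → ℂ)
  inj : ∀ φ : W, toFun φ = 0 → φ = 0
  deriv_bv : ∀ φ : W, ∃ g : ℝ → ℂ, BoundedVariationOn g Set.univ ∧
    Function.support g ⊆ Set.Icc a b ∧ ∀ x, toFun φ x = -∫ t in Set.Ioc x b, g t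
  surj : ∀ g : ℝ → ℂ, BoundedVariationOn g Set.univ → Function.support g ⊆ Set.Icc a b →
    ∃ φ : W, ∀ x, toFun φ x = -∫ t in Set.Ioc x b, g t
  norm_eq : ∀ φ : W, ENNReal.ofReal ‖φ‖ =
    ⨅ g ∈ {g : ℝ → ℂ | ∀ x, toFun φ x = -∫ t in Set.Ioc x b, g t}, eVariationOn g Set.univ



open scoped BoundedContinuousFunction

section nemytskii

variable {X : Type} [TopologicalSpace X]
variable {E : Type} [NormedAddCommGroup E] [NormedSpace ℝ E]

lemma bcfApply_bound {F : Type} [NormedAddCommGroup F] [NormedSpace ℝ F]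
    (A : X →ᵇ (E →L[ℝ] F)) (v : X →ᵇ E) (x : X) : ‖A x (v x)‖ ≤ ‖A‖ * ‖v‖ :=
  ((A x).le_opNorm (v x)).trans
    (mul_le_mul (A.norm_coe_le_norm x) (v.norm_coe_le_norm x) (norm_nonneg _) (by positivity))

/-- The bilinear evaluation map on bounded continuous functions. -/
def bcfApply (X : Type) [TopologicalSpace X] (E F : Type) [NormedAddCommGroup E] [NormedSpace ℝ E]
    [NormedAddCommGroup F] [NormedSpace ℝ F] :
    (X →ᵇ (E →L[ℝ] F)) →L[ℝ] (X →ᵇ E) →L[ℝ] (X →ᵇ F) :=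
  LinearMap.mkContinuous₂
    (LinearMap.mk₂ ℝ (fun (A : X →ᵇ (E →L[ℝ] F)) (v : X →ᵇ E) =>
        BoundedContinuousFunction.ofNormedAddCommGroup (fun x => A x (v x))
          (A.continuous.clm_apply v.continuous) (‖A‖ * ‖v‖) (bcfApply_bound A v))
      (by intros; ext; simp) (by intros; ext; simp) (by intros; ext; simp) (by intros; ext; simp))
    1 (by
      intro A v
      rw [one_mul]
      exact BoundedContinuousFunction.norm_ofNormedAddCommGroup_le _ (by positivity)
        (bcfApply_bound A v))

@[simp] lemma bcfApply_apply {F : Type} [NormedAddCommGroup F] [NormedSpace ℝ F]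
    (A : X →ᵇ (E →L[ℝ] F)) (v : X →ᵇ E) (x : X) : bcfApply X E F A v x = A x (v x) := rfl

/-- A compactly supported continuous function as a bounded continuous function. -/
def bcfOf {F : Type} [NormedAddCommGroup F] (G : E → F) (hc : Continuous G)
    (hs : HasCompactSupport G) : E →ᵇ F :=
  BoundedContinuousFunction.ofNormedAddCommGroup G hc
    (hs.exists_bound_of_continuous hc).choose (hs.exists_bound_of_continuous hc).choose_spec

theorem nem_contDiff (n : ℕ) : ∀ {F : Type} [NormedAddCommGroup F] [NormedSpace ℝ F]
    (G : E →ᵇ F), ContDiff ℝ n G → HasCompactSupport G →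
    ContDiff ℝ n (fun u : X →ᵇ E => G.compContinuous u.toContinuousMap) := by
  induction n with
  | zero =>
    intro F _ _ G hG hs
    have hu := hs.uniformContinuous_of_continuous G.continuous
    simp only [Nat.cast_zero, contDiff_zero]
    rw [Metric.continuous_iff]
    intro u ε hε
    obtain ⟨δ, hδ, h⟩ := Metric.uniformContinuous_iff.1 hu (ε/2) (half_pos hε)
    refine ⟨δ, hδ, fun v hv => ?_⟩
    refine lt_of_le_of_lt ?_ (half_lt_self hε)
    rw [BoundedContinuousFunction.dist_le (half_pos hε).le]
    intro x
    exact (h ((BoundedContinuousFunction.dist_coe_le_dist x).trans_lt hv)).le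
  | succ n ih =>
    intro F _ _ G hG hs
    have hG1 : ContDiff ℝ 1 G := hG.of_le (by norm_cast; omega)
    have hdc : Continuous (fderiv ℝ G) := hG1.continuous_fderiv one_ne_zero
    have hds : HasCompactSupport (fderiv ℝ G) := hs.fderiv ℝ
    have hdG : ContDiff ℝ n (fderiv ℝ G) := hG.fderiv_right (by norm_cast)
    have hdiff : Differentiable ℝ G := hG1.differentiable one_ne_zero
    let DG : E →ᵇ (E →L[ℝ] F) := bcfOf (fderiv ℝ G) hdc hds
    have key := ih DG hdG hds
    rw [show ((n + 1 : ℕ) : WithTop ℕ∞) = (n : WithTop ℕ∞) + 1 by norm_cast,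
      contDiff_succ_iff_hasFDerivAt]
    refine ⟨fun u => bcfApply X E F (DG.compContinuous u.toContinuousMap),
      ?_, fun u => ?_⟩
    · have hL : ContDiff ℝ n (bcfApply X E F) := by
        exact ContinuousLinearMap.contDiff (𝕜 := ℝ) (E := X →ᵇ (E →L[ℝ] F)) (F := (X →ᵇ E) →L[ℝ] (X →ᵇ F)) (bcfApply X E F)
      exact ContDiff.comp (g := bcfApply X E F) hL key
    have hu := hds.uniformContinuous_of_continuous hdc
    rw [hasFDerivAt_iff_isLittleO_nhds_zero, Asymptotics.isLittleO_iff]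
    intro ε hε
    obtain ⟨δ, hδ, h⟩ := Metric.uniformContinuous_iff.1 hu ε hε
    filter_upwards [Metric.ball_mem_nhds (0 : X →ᵇ E) hδ] with v hv
    rw [BoundedContinuousFunction.norm_le (by positivity)]
    intro x
    have hvx : ‖v x‖ < δ := (v.norm_coe_le_norm x).trans_lt (by simpa using hv)
    have := (convex_ball (u x) δ).norm_image_sub_le_of_norm_hasFDerivWithin_le' (f := G)
      (f' := fderiv ℝ G) (φ := fderiv ℝ G (u x)) (C := ε) (x := u x) (y := u x + v x)
      (fun y _ => (hdiff y).hasFDerivAt.hasFDerivWithinAt)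
      (fun y hy => by
        have := h (a := y) (b := u x) hy
        rw [dist_eq_norm] at this
        exact this.le)
      (Metric.mem_ball_self hδ) (by simpa using hvx)
    rw [add_sub_cancel_left] at this
    refine le_trans ?_ (this.trans (mul_le_mul_of_nonneg_left (v.norm_coe_le_norm x) hε.le))
    exact le_of_eq rfl

end nemytskii

/-- Cutoff lemma. -/
theorem exists_cutoff (n : ℕ) (K : Set ℝ) (hK : IsCompact K) (W : Set (ℝ × ℝ)) (hW : IsOpen W)
    (hKW : K ×ˢ ({0} : Set ℝ) ⊆ W) (G : ℝ × ℝ → ℝ) (hG : ContDiffOn ℝ n G W) :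
    ∃ Gt : ℝ × ℝ → ℝ, ContDiff ℝ n Gt ∧ HasCompactSupport Gt ∧ ∃ δ : ℝ, 0 < δ ∧
      ∀ x ∈ K, ∀ t : ℝ, |t| < δ → (x, t) ∈ W ∧ Gt (x, t) = G (x, t) := by
  have hKc : IsCompact (K ×ˢ ({0} : Set ℝ)) := hK.prod isCompact_singleton
  obtain ⟨L, hL, hKL, hLW⟩ := exists_compact_between hKc hW hKW
  obtain ⟨φ, hφ1, hφ0, -⟩ := exists_contMDiffMap_one_nhds_of_subset_interior
    (n := n) (modelWithCornersSelf ℝ (ℝ × ℝ)) hKc.isClosed hKL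
  have hφ : ContDiff ℝ n φ := φ.contMDiff.contDiff
  have hsupp : Function.support (fun p => φ p * G p) ⊆ L := by
    intro p hp
    by_contra h
    exact hp (by simp [hφ0 p h])
  refine ⟨fun p => φ p * G p, ?_, ?_, ?_⟩
  · rw [contDiff_iff_contDiffAt]
    intro p
    by_cases hp : p ∈ W
    · exact hφ.contDiffAt.mul (hG.contDiffAt (hW.mem_nhds hp))
    · have hp' : p ∈ Lᶜ := fun h => hp (hLW h)
      refine (contDiffAt_const (c := (0:ℝ))).congr_of_eventuallyEq ?_
      filter_upwards [hL.isClosed.isOpen_compl.mem_nhds hp'] with q hq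
      simp [hφ0 q hq]
  · exact HasCompactSupport.intro hL (fun p hp => by simp [hφ0 p hp])
  · obtain ⟨V, hVs, hVo, hV⟩ : ∃ V ⊆ {p | φ p = 1}, IsOpen V ∧ K ×ˢ ({0} : Set ℝ) ⊆ V := by
      obtain ⟨V, hVo, hKV, hV⟩ := mem_nhdsSet_iff_exists.1 hφ1
      exact ⟨V, hV, hVo, hKV⟩
    obtain ⟨u, v, hu, hv, hKu, h0v, huv⟩ := generalized_tube_lemma hK
      (isCompact_singleton (x := (0:ℝ))) (hVo.inter hW) (subset_inter hV hKW)
    obtain ⟨δ, hδ, hb⟩ := Metric.isOpen_iff.1 hv 0 (h0v rfl)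
    refine ⟨δ, hδ, fun x hx t ht => ?_⟩
    have := huv (mk_mem_prod (hKu hx) (hb (by simpa using ht : t ∈ Metric.ball 0 δ)))
    refine ⟨this.2, ?_⟩
    have h1 : φ (x, t) = 1 := hVs this.1
    simp [h1]

section implicit

variable {X : Type} [TopologicalSpace X] [DiscreteTopology X]

/-- The linear map `(u,t) ↦ (x ↦ (u x, t))`. -/
def pairCLM (X : Type) [TopologicalSpace X] :
    ((X →ᵇ ℝ) × ℝ) →L[ℝ] (X →ᵇ (ℝ × ℝ)) :=
  LinearMap.mkContinuous
    { toFun := fun p => BoundedContinuousFunction.ofNormedAddCommGroup (fun x => (p.1 x, p.2))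
        (p.1.continuous.prodMk continuous_const) ‖p‖
        (fun x => max_le_max (p.1.norm_coe_le_norm x) le_rfl)
      map_add' := by intros; ext <;> simp
      map_smul' := by intros; ext <;> simp }
    1 (by
      intro p
      rw [one_mul]
      exact BoundedContinuousFunction.norm_ofNormedAddCommGroup_le _ (norm_nonneg p)
        (fun x => max_le_max (p.1.norm_coe_le_norm x) le_rfl))

lemma pairCLM_apply {X : Type} [TopologicalSpace X] (p : (X →ᵇ ℝ) × ℝ) (x : X) : pairCLM X p x = (p.1 x, p.2) := rfl

/-- Composition with a self-map of a discrete space. -/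
def compCLM (f : X → X) : (X →ᵇ ℝ) →L[ℝ] (X →ᵇ ℝ) :=
  LinearMap.mkContinuous
    { toFun := fun p => BoundedContinuousFunction.ofNormedAddCommGroup (fun x => p (f x))
        continuous_of_discreteTopology ‖p‖
        (fun x => p.norm_coe_le_norm (f x))
      map_add' := by intros; ext; simp
      map_smul' := by intros; ext; simp }
    1 (by
      intro p
      rw [one_mul]
      exact BoundedContinuousFunction.norm_ofNormedAddCommGroup_le _ (norm_nonneg p)
        (fun x => p.norm_coe_le_norm (f x)))

lemma compCLM_apply (f : X → X) (p : X →ᵇ ℝ) (x : X) : compCLM f p x = p (f x) := rfl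

/-- The twisted cohomological operator is bijective. -/
theorem twisted_bijective (f : X → X) (m : X → ℝ) (κ : ℝ) (hκ : 1 < κ) (hm : ∀ x, κ ≤ |m x|)
    (A : (X →ᵇ ℝ) →L[ℝ] (X →ᵇ ℝ)) (hA : ∀ v x, A v x = m x * v x - v (f x)) :
    Function.Bijective A := by
  have hκ0 : 0 < κ := by linarith
  constructor
  · rw [injective_iff_map_eq_zero]
    intro v hv
    have h1 : ‖v‖ ≤ κ⁻¹ * ‖v‖ := by
      rw [BoundedContinuousFunction.norm_le (by positivity)]
      intro x
      have h2 : m x * v x = v (f x) := by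
        have := hA v x
        rw [hv] at this
        simp at this
        linarith
      have h3 : |m x| * |v x| ≤ ‖v‖ := by
        rw [← abs_mul, h2]
        exact v.norm_coe_le_norm (f x)
      have h4 : κ * |v x| ≤ ‖v‖ :=
        (mul_le_mul_of_nonneg_right (hm x) (abs_nonneg _)).trans h3
      rw [Real.norm_eq_abs, inv_mul_eq_div, le_div_iff₀ hκ0]
      linarith
    have h5 : ‖v‖ = 0 := by
      rw [inv_mul_eq_div, le_div_iff₀ hκ0] at h1
      nlinarith [norm_nonneg v]
    exact norm_eq_zero.1 h5
  · intro w
    have hmi : ∀ x, |(m x)⁻¹| ≤ κ⁻¹ := fun x => by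
      rw [abs_inv]
      exact inv_anti₀ hκ0 (hm x)
    have hm0 : ∀ x, m x ≠ 0 := fun x h => by
      have := hm x
      rw [h] at this
      simp at this
      linarith
    let mi : X →ᵇ ℝ := BoundedContinuousFunction.ofNormedAddCommGroup (fun x => (m x)⁻¹)
      continuous_of_discreteTopology κ⁻¹ hmi
    have hmin : ‖mi‖ ≤ κ⁻¹ :=
      BoundedContinuousFunction.norm_ofNormedAddCommGroup_le _ (by positivity) hmi
    let T : (X →ᵇ ℝ) → (X →ᵇ ℝ) := fun v => mi * (w + compCLM f v)
    have hT : ContractingWith (Real.toNNReal κ⁻¹) T := by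
      refine ⟨?_, LipschitzWith.of_dist_le_mul fun u v => ?_⟩
      · rw [Real.toNNReal_lt_one]
        exact inv_lt_one_of_one_lt₀ hκ
      · rw [Real.coe_toNNReal _ (by positivity), dist_eq_norm, dist_eq_norm]
        have : T u - T v = mi * compCLM f (u - v) := by
          simp only [T, map_sub]
          ring
        rw [this]
        refine (norm_mul_le _ _).trans (mul_le_mul hmin ?_ (norm_nonneg _) (by positivity))
        refine ((compCLM f).le_opNorm _).trans ?_
        have : ‖compCLM f‖ ≤ 1 := LinearMap.mkContinuous_norm_le _ zero_le_one _
        nlinarith [norm_nonneg (u - v)]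
    refine ⟨ContractingWith.fixedPoint T hT, ?_⟩
    have hfix := hT.fixedPoint_isFixedPt
    set v := ContractingWith.fixedPoint T hT
    ext x
    rw [hA]
    have h1 : v x = (m x)⁻¹ * (w x + v (f x)) := by
      conv_lhs => rw [← hfix.eq]
      rfl
    rw [h1, mul_inv_cancel_left₀ (hm0 x)]
    ring

theorem implicit_motion (n : ℕ) (hn : n ≠ 0) (Gp Gm : ℝ × ℝ → ℝ)
    (hGp : ContDiff ℝ n Gp) (hGm : ContDiff ℝ n Gm)
    (hsp : HasCompactSupport Gp) (hsm : HasCompactSupport Gm)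
    (P Q : X →ᵇ ℝ) (f : X → X) (u0 : X →ᵇ ℝ) (κ : ℝ) (hκ : 1 < κ)
    (hm : ∀ x, κ ≤ |P x * fderiv ℝ Gp (u0 x, 0) (1, 0) + Q x * fderiv ℝ Gm (u0 x, 0) (1, 0)|)
    (H : ℝ → (X →ᵇ ℝ)) (hH0 : H 0 = u0) (hH : Tendsto H (𝓝 0) (𝓝 u0))
    (heq : ∀ᶠ t in 𝓝 (0:ℝ), ∀ x, P x * Gp (H t x, t) + Q x * Gm (H t x, t) = H t (f x)) :
    ContDiffAt ℝ n H 0 := by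
  have hn1 : (n : WithTop ℕ∞) ≠ 0 := by exact_mod_cast hn
  let bp := bcfOf Gp hGp.continuous hsp
  let bm := bcfOf Gm hGm.continuous hsm
  let Φ : (X →ᵇ ℝ) × ℝ → (X →ᵇ ℝ) := fun p =>
    P * bp.compContinuous (pairCLM X p).toContinuousMap +
    Q * bm.compContinuous (pairCLM X p).toContinuousMap - compCLM f p.1
  have hΦ : ContDiff ℝ n Φ := by
    have h1 : ContDiff ℝ n (fun p : (X →ᵇ ℝ) × ℝ =>
        bp.compContinuous (pairCLM X p).toContinuousMap) :=
      (nem_contDiff (X := X) n bp hGp hsp).comp (pairCLM X).contDiff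
    have h2 : ContDiff ℝ n (fun p : (X →ᵇ ℝ) × ℝ =>
        bm.compContinuous (pairCLM X p).toContinuousMap) :=
      (nem_contDiff (X := X) n bm hGm hsm).comp (pairCLM X).contDiff
    exact ((contDiff_const.mul h1).add (contDiff_const.mul h2)).sub
      ((compCLM f).contDiff.comp contDiff_fst)
  have hΦx : ∀ p x, Φ p x = P x * Gp (p.1 x, p.2) + Q x * Gm (p.1 x, p.2) - p.1 (f x) :=
    fun p x => rfl
  have hΦd : HasFDerivAt Φ (fderiv ℝ Φ (u0, 0)) (u0, 0) :=
    (hΦ.differentiable hn1 _).hasFDerivAt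
  set D := fderiv ℝ Φ (u0, 0) with hD
  have hDx : ∀ v x, D (v, 0) x = (P x * fderiv ℝ Gp (u0 x, 0) (1, 0)
      + Q x * fderiv ℝ Gm (u0 x, 0) (1, 0)) * v x - v (f x) := by
    intro v x
    have e1 : HasDerivAt (fun s : ℝ => Φ ((u0, 0) + s • (v, (0:ℝ))) x) (D (v, 0) x) 0 := by
      have hl : HasDerivAt (fun s : ℝ => (u0, (0:ℝ)) + s • (v, (0:ℝ))) (v, (0:ℝ)) 0 := by
        simpa using ((hasDerivAt_id (0:ℝ)).smul_const (v, (0:ℝ))).const_add (u0, (0:ℝ))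
      have := HasFDerivAt.comp_hasDerivAt (0:ℝ) (f := fun s : ℝ => (u0, (0:ℝ)) + s • (v, (0:ℝ)))
        (l := Φ) (l' := D) (by simpa using hΦd) hl
      exact (BoundedContinuousFunction.evalCLM ℝ x).hasFDerivAt.comp_hasDerivAt (0:ℝ) this
    have hl : HasDerivAt (fun s : ℝ => (u0 x + s * v x, (0:ℝ))) (v x, (0:ℝ)) 0 := by
      have : HasDerivAt (fun s : ℝ => u0 x + s * v x) (v x) 0 := by
        simpa using ((hasDerivAt_id (0:ℝ)).mul_const (v x)).const_add (u0 x)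
      exact this.prodMk (hasDerivAt_const _ _)
    have e2 : ∀ G : ℝ × ℝ → ℝ, ContDiff ℝ n G →
        HasDerivAt (fun s : ℝ => G (u0 x + s * v x, 0)) (fderiv ℝ G (u0 x, 0) (1, 0) * v x) 0 := by
      intro G hG
      have := HasFDerivAt.comp_hasDerivAt (0:ℝ) (f := fun s : ℝ => (u0 x + s * v x, (0:ℝ)))
        (l := G) (l' := fderiv ℝ G (u0 x, 0))
        (by simpa using (hG.differentiable hn1 (u0 x, 0)).hasFDerivAt) hl
      have e : fderiv ℝ G (u0 x, 0) (1, 0) * v x = fderiv ℝ G (u0 x, 0) (v x, 0) := by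
        rw [show (v x, (0:ℝ)) = v x • ((1:ℝ), (0:ℝ)) by simp, map_smul, smul_eq_mul, mul_comm]
      rw [e]
      exact this
    have e3 : HasDerivAt (fun s : ℝ => u0 (f x) + s * v (f x)) (v (f x)) 0 := by
      simpa using ((hasDerivAt_id (0:ℝ)).mul_const (v (f x))).const_add (u0 (f x))
    have e4 := (((e2 Gp hGp).const_mul (P x)).add ((e2 Gm hGm).const_mul (Q x))).sub e3
    have e5 : (fun s : ℝ => Φ ((u0, 0) + s • (v, (0:ℝ))) x) =
      (fun s => P x * Gp (u0 x + s * v x, 0) + Q x * Gm (u0 x + s * v x, 0)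
        - (u0 (f x) + s * v (f x))) := by
      funext s
      rw [hΦx]
      simp
    rw [e5] at e1
    have := e1.unique e4
    rw [this]
    ring
  have hbij : Function.Bijective (D.comp (ContinuousLinearMap.inl ℝ (X →ᵇ ℝ) ℝ)) :=
    twisted_bijective f _ κ hκ hm _ (fun v x => by simpa using hDx v x)
  let Θ : (X →ᵇ ℝ) × ℝ → (X →ᵇ ℝ) × ℝ := fun p => (Φ p, p.2)
  let DΘ : ((X →ᵇ ℝ) × ℝ) →L[ℝ] ((X →ᵇ ℝ) × ℝ) :=
    D.prod (ContinuousLinearMap.snd ℝ (X →ᵇ ℝ) ℝ)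
  have hΘ : ContDiff ℝ n Θ := hΦ.prodMk contDiff_snd
  have hΘd : HasFDerivAt Θ DΘ (u0, 0) := hΦd.prodMk hasFDerivAt_snd
  have hinj : Function.Injective DΘ := by
    rw [injective_iff_map_eq_zero]
    rintro ⟨v, s⟩ hvs
    have h1 : D (v, s) = 0 := congrArg Prod.fst hvs
    have h2 : s = 0 := congrArg Prod.snd hvs
    subst h2
    have h3 : v = 0 := by
      apply hbij.1
      rw [map_zero]
      exact h1
    rw [h3]; rfl
  have hsurj : Function.Surjective DΘ := by
    rintro ⟨w, s⟩
    obtain ⟨v, hv⟩ := hbij.2 (w - D (0, s))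
    refine ⟨(v, s), ?_⟩
    have h1 : D (v, s) = w := by
      have : (v, s) = (v, (0:ℝ)) + ((0 : X →ᵇ ℝ), s) := by simp
      rw [this, map_add]
      have hv' : D (v, 0) = w - D (0, s) := by simpa using hv
      rw [hv']; abel
    exact Prod.ext h1 rfl
  let e : ((X →ᵇ ℝ) × ℝ) ≃L[ℝ] ((X →ᵇ ℝ) × ℝ) :=
    ContinuousLinearEquiv.ofBijective DΘ (LinearMap.ker_eq_bot.2 hinj)
      (LinearMap.range_eq_top.2 hsurj)
  have hΘe : HasFDerivAt Θ (e : ((X →ᵇ ℝ) × ℝ) →L[ℝ] ((X →ᵇ ℝ) × ℝ)) (u0, 0) := by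
    have : (e : ((X →ᵇ ℝ) × ℝ) →L[ℝ] ((X →ᵇ ℝ) × ℝ)) = DΘ := by
      ext1 <;> rfl
    rw [this]; exact hΘd
  have hΘa : ContDiffAt ℝ n Θ (u0, 0) := hΘ.contDiffAt
  have hinv := hΘa.to_localInverse hΘe hn1
  have hleft : ∀ᶠ p in 𝓝 (u0, (0:ℝ)), hΘa.localInverse hΘe hn1 (Θ p) = p :=
    (hΘa.hasStrictFDerivAt' hΘe hn1).eventually_left_inverse
  have hHt : Tendsto (fun t : ℝ => (H t, t)) (𝓝 0) (𝓝 (u0, 0)) :=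
    hH.prodMk_nhds tendsto_id
  have hΘ0 : Θ (u0, 0) = (0, 0) := by
    refine Prod.ext ?_ rfl
    ext x
    have := heq.self_of_nhds x
    rw [hH0] at this
    change Φ (u0, 0) x = 0
    rw [hΦx]
    simp [this]
  have hev : H =ᶠ[𝓝 0] fun t => (hΘa.localInverse hΘe hn1 ((0 : X →ᵇ ℝ), t)).1 := by
    filter_upwards [hHt.eventually hleft, heq] with t h1 h2
    have : Θ (H t, t) = (0, t) := by
      refine Prod.ext ?_ rfl
      ext x
      change Φ (H t, t) x = 0
      rw [hΦx]
      simp [h2 x]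
    rw [this] at h1
    rw [h1]
  refine ContDiffAt.congr_of_eventuallyEq ?_ hev
  rw [hΘ0] at hinv
  exact contDiffAt_fst.comp (0:ℝ)
    (ContDiffAt.comp (0:ℝ) hinv (contDiffAt_const.prodMk contDiffAt_id))

end implicit

/-- The interval `[a,b]` with the discrete topology. -/
structure DiscI (a b : ℝ) : Type where
  val : ℝ
  mem : val ∈ Set.Icc a b

instance (a b : ℝ) : TopologicalSpace (DiscI a b) := ⊥

instance (a b : ℝ) : DiscreteTopology (DiscI a b) := ⟨rfl⟩

theorem post_bounds {X : Type} [TopologicalSpace X] (n : ℕ) (hn : n ≠ 0) (H : ℝ → (X →ᵇ ℝ))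
    (hH : ContDiffAt ℝ n H 0) (ε : ℝ) (hε : 0 < ε) :
    ∃ ε' : ℝ, 0 < ε' ∧ ε' < ε ∧ ContinuousOn H (Set.Icc (-ε') ε') ∧
      ∃ M : NNReal, ∀ x : X,
        ContDiffOn ℝ n (fun t => H t x) (Set.Icc (-ε') ε') ∧
        (∀ i ≤ n - 1, ∀ t ∈ Set.Icc (-ε') ε',
          |iteratedDerivWithin i (fun u => H u x) (Set.Icc (-ε') ε') t| ≤ M) ∧
        LipschitzOnWith M
          (iteratedDerivWithin (n - 1) (fun u => H u x) (Set.Icc (-ε') ε'))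
          (Set.Icc (-ε') ε') := by
  obtain ⟨u, hu, hHu⟩ : ∃ u ∈ 𝓝 (0:ℝ), ContDiffOn ℝ n H u := by
    obtain ⟨u, hu, h⟩ := hH.contDiffOn (m := n) le_rfl (by simp)
    exact ⟨u, hu, h⟩
  obtain ⟨δ, hδ, hb⟩ := Metric.mem_nhds_iff.1 hu
  have hδε : 0 < min δ ε := lt_min hδ hε
  refine ⟨min δ ε / 2, by positivity, (half_lt_self hδε).trans_le (min_le_right _ _), ?_⟩
  have hepos : 0 < min δ ε / 2 := by positivity
  have hedel : min δ ε / 2 < δ := (half_lt_self hδε).trans_le (min_le_left _ _)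
  set e := min δ ε / 2
  set S := Set.Icc (-e) e with hSdef
  have hS : UniqueDiffOn ℝ S := uniqueDiffOn_Icc (by linarith)
  have hHS : ContDiffOn ℝ n H S := hHu.mono fun t ht => hb (by
    rw [Metric.mem_ball, dist_zero_right, Real.norm_eq_abs]
    exact (abs_le.2 ht).trans_lt hedel)
  refine ⟨hHS.continuousOn, ?_⟩
  have hbd : ∀ i : ℕ, ∃ B : ℝ, i ≤ n → ∀ t ∈ S, ‖iteratedDerivWithin i H S t‖ ≤ B := by
    intro i
    by_cases hi : i ≤ n
    · obtain ⟨B, hB⟩ := isCompact_Icc.exists_bound_of_continuousOn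
        (hHS.continuousOn_iteratedDerivWithin (m := i) (by exact_mod_cast hi) hS)
      exact ⟨B, fun _ => hB⟩
    · exact ⟨0, fun h => absurd h hi⟩
  choose B hB using hbd
  let M : NNReal := ∑ i ∈ Finset.range (n + 1), Real.toNNReal (B i)
  have hM : ∀ i ≤ n, B i ≤ M := by
    intro i hi
    have h1 : Real.toNNReal (B i) ≤ M :=
      Finset.single_le_sum (f := fun i => Real.toNNReal (B i)) (fun _ _ => zero_le)
        (Finset.mem_range.2 (by omega))
    exact (Real.le_coe_toNNReal _).trans (NNReal.coe_le_coe.2 h1)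
  refine ⟨M, fun x => ?_⟩
  have hx : ContDiffOn ℝ n (fun t => H t x) S := by
    have hL : ContDiff ℝ n (BoundedContinuousFunction.evalCLM ℝ x : (X →ᵇ ℝ) →L[ℝ] ℝ) :=
      ContinuousLinearMap.contDiff (𝕜 := ℝ) (E := X →ᵇ ℝ) (F := ℝ)
        (BoundedContinuousFunction.evalCLM ℝ x)
    exact hL.comp_contDiffOn hHS
  have hid : ∀ i ≤ n, ∀ t ∈ S, iteratedDerivWithin i (fun u => H u x) S t =
      iteratedDerivWithin i H S t x := by
    intro i hi t ht
    have h1 := (BoundedContinuousFunction.evalCLM ℝ x).iteratedFDerivWithin_comp_left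
      (f := H) (s := S) (x := t) (n := n) (i := i) (hHS t ht) hS ht (by exact_mod_cast hi)
    rw [iteratedDerivWithin_eq_iteratedFDerivWithin, iteratedDerivWithin_eq_iteratedFDerivWithin]
    exact congrArg (fun L => L (fun _ => 1)) h1
  have hbx : ∀ i ≤ n, ∀ t ∈ S, |iteratedDerivWithin i (fun u => H u x) S t| ≤ M := by
    intro i hi t ht
    rw [hid i hi t ht]
    exact ((iteratedDerivWithin i H S t).norm_coe_le_norm x).trans ((hB i hi t ht).trans (hM i hi))
  refine ⟨hx, fun i hi => hbx i (by omega), ?_⟩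
  refine (convex_Icc (-e) e).lipschitzOnWith_of_nnnorm_derivWithin_le
    (hx.differentiableOn_iteratedDerivWithin (m := n - 1)
      (by exact_mod_cast (show n - 1 < n by omega)) hS) ?_
  intro t ht
  rw [← NNReal.coe_le_coe, coe_nnnorm, Real.norm_eq_abs]
  have := hbx n le_rfl t ht
  obtain ⟨k, rfl⟩ := Nat.exists_eq_succ_of_ne_zero hn
  rw [Nat.succ_eq_add_one, iteratedDerivWithin_succ] at this
  exact this

/-- Mean value lower bound. -/
theorem expand_lower (p q κ : ℝ) (U : Set ℝ) (hsub : Set.Icc p q ⊆ U)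
    (f g : ℝ → ℝ) (hfg : Set.EqOn g f (Set.Icc p q)) (hg : DifferentiableOn ℝ g U)
    (hexp : ∀ x ∈ U, κ ≤ |deriv g x|) :
    ∀ x ∈ Set.Icc p q, ∀ y ∈ Set.Icc p q, κ * |x - y| ≤ |f x - f y| := by
  have key : ∀ x ∈ Set.Icc p q, ∀ y ∈ Set.Icc p q, x < y → κ * |x - y| ≤ |f x - f y| := by
    intro x hx y hy hxy
    have hsub' : Set.Icc x y ⊆ U := (Set.Icc_subset_Icc hx.1 hy.2).trans hsub
    obtain ⟨z, hz, hzd⟩ := exists_deriv_eq_slope g hxy (hg.continuousOn.mono hsub')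
      (hg.mono (Set.Ioo_subset_Icc_self.trans hsub'))
    have h1 := hexp z (hsub' (Set.Ioo_subset_Icc_self hz))
    have hxy' : 0 < y - x := by linarith
    rw [hzd, abs_div, abs_of_pos hxy', le_div_iff₀ hxy', hfg hx, hfg hy] at h1
    rw [abs_sub_comm x y, abs_of_pos hxy', abs_sub_comm (f x)]
    exact h1
  intro x hx y hy
  rcases lt_trichotomy x y with h | h | h
  · exact key x hx y hy h
  · simp [h]
  · rw [abs_sub_comm x y, abs_sub_comm (f x)]
    exact key y hy x hx h

/-- The `x`-derivative of the extension agrees with the one-sided derivative. -/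
theorem partial_deriv_eq (p q : ℝ) (hpq : p < q) (g : ℝ → ℝ) (U : Set ℝ) (hU : IsOpen U)
    (hsub : Set.Icc p q ⊆ U) (hg : DifferentiableOn ℝ g U) (G : ℝ × ℝ → ℝ)
    (hG : Differentiable ℝ G) (heq : ∀ x ∈ Set.Icc p q, G (x, 0) = g x) (x : ℝ)
    (hx : x ∈ Set.Icc p q) : fderiv ℝ G (x, 0) (1, 0) = deriv g x := by
  have h1 : HasDerivWithinAt g (deriv g x) (Set.Icc p q) x :=
    ((hg x (hsub hx)).differentiableAt (hU.mem_nhds (hsub hx))).hasDerivAt.hasDerivWithinAt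
  have h2 : HasDerivAt (fun s : ℝ => G (s, 0)) (fderiv ℝ G (x, 0) (1, 0)) x :=
    HasFDerivAt.comp_hasDerivAt x (f := fun s : ℝ => (s, (0:ℝ))) (l := G)
      (hG (x, 0)).hasFDerivAt ((hasDerivAt_id x).prodMk (hasDerivAt_const x (0:ℝ)))
  have h3 := h2.hasDerivWithinAt (s := Set.Icc p q)
  have h4 : HasDerivWithinAt g (fderiv ℝ G (x, 0) (1, 0)) (Set.Icc p q) x :=
    h3.congr (fun y hy => (heq y hy).symm) (heq x hx).symm
  exact (uniqueDiffOn_Icc hpq x hx).eq_deriv _ h4 h1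

namespace ConjFamily

variable {r₀ r : ℕ} {F : PWUnimodal r} {ε : ℝ}

theorem h_strictMono (C : ConjFamily r₀ r F ε) (t : ℝ) (ht : |t| < ε) :
    StrictMonoOn (C.h t) (Set.Icc F.a F.b) := by
  have hab : F.a < F.b := F.hac.trans F.hcb
  rcases (C.h_cont t ht).strictMonoOn_of_injOn_Icc' hab.le (C.h_bij t ht).injOn with h | h
  · exact h
  · exfalso
    have ha : F.a ∈ Set.Icc F.a F.b := ⟨le_rfl, hab.le⟩
    have hb : F.b ∈ Set.Icc F.a F.b := ⟨hab.le, le_rfl⟩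
    have h1 : C.h t F.a = F.b := by
      obtain ⟨y, hy, hyb⟩ := (C.h_bij t ht).surjOn hb
      refine le_antisymm ((C.h_bij t ht).mapsTo ha).2 ?_
      rw [← hyb]
      exact h.antitoneOn ha hy hy.1
    have h2 := C.h_conj t ht F.a ha
    rw [F.fa, h1] at h2
    have h3 := (C.fam t).fb
    rw [C.same_a, C.same_b] at h3
    rw [h3] at h2
    exact hab.ne h2

theorem f_close (C : ConjFamily r₀ r F ε) (t : ℝ) (ht : |t| < ε) (x : ℝ)
    (hx : x ∈ Set.Icc F.a F.b) : |F.f x - (C.fam t).f x| ≤ C.Cb * |t| := by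
  rcases le_total x F.c with hc | hc
  · have hx' : x ∈ Set.Icc F.a F.c := ⟨hx.1, hc⟩
    have h1 := C.close_p t ht 0 (Nat.zero_le _) x (C.subVp hx')
    have h2 : (C.fam t).fp x = (C.fam t).f x :=
      (C.fam t).fp_eq (by rw [C.same_a, C.same_c]; exact hx')
    rw [iteratedDeriv_zero, F.fp_eq hx', h2] at h1
    exact h1
  · have hx' : x ∈ Set.Icc F.c F.b := ⟨hc, hx.2⟩
    have h1 := C.close_m t ht 0 (Nat.zero_le _) x (C.subVm hx')
    have h2 : (C.fam t).fm x = (C.fam t).f x :=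
      (C.fam t).fm_eq (by rw [C.same_b, C.same_c]; exact hx')
    rw [iteratedDeriv_zero, F.fm_eq hx', h2] at h1
    exact h1

theorem h_left (C : ConjFamily r₀ r F ε) (t : ℝ) (ht : |t| < ε) (x : ℝ)
    (hx : x ∈ Set.Icc F.a F.c) : C.h t x ∈ Set.Icc F.a F.c := by
  have hxI : x ∈ Set.Icc F.a F.b := ⟨hx.1, hx.2.trans F.hcb.le⟩
  have hcI : F.c ∈ Set.Icc F.a F.b := ⟨F.hac.le, F.hcb.le⟩
  refine ⟨((C.h_bij t ht).mapsTo hxI).1, ?_⟩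
  have := (C.h_strictMono t ht).monotoneOn hxI hcI hx.2
  rwa [C.h_c t ht] at this

theorem h_right (C : ConjFamily r₀ r F ε) (t : ℝ) (ht : |t| < ε) (x : ℝ)
    (hx : x ∈ Set.Icc F.c F.b) : C.h t x ∈ Set.Icc F.c F.b := by
  have hxI : x ∈ Set.Icc F.a F.b := ⟨F.hac.le.trans hx.1, hx.2⟩
  have hcI : F.c ∈ Set.Icc F.a F.b := ⟨F.hac.le, F.hcb.le⟩
  refine ⟨?_, ((C.h_bij t ht).mapsTo hxI).2⟩
  have := (C.h_strictMono t ht).monotoneOn hcI hxI hx.1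
  rwa [C.h_c t ht] at this

theorem h_estimate (C : ConjFamily r₀ r F ε) (hr : r ≠ 0) (t : ℝ) (ht : |t| < ε) (x : ℝ)
    (hx : x ∈ Set.Icc F.a F.b) :
    F.κ * |C.h t x - x| ≤ |C.h t (F.f x) - F.f x| + C.Cb * |t| := by
  have hr1 : (r : WithTop ℕ∞) ≠ 0 := by exact_mod_cast hr
  have h1 : F.κ * |C.h t x - x| ≤ |F.f (C.h t x) - F.f x| := by
    rcases le_total x F.c with hc | hc
    · have hx' : x ∈ Set.Icc F.a F.c := ⟨hx.1, hc⟩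
      exact expand_lower F.a F.c F.κ F.Up F.subUp F.f F.fp F.fp_eq
        (F.fp_smooth.differentiableOn hr1) F.fp_exp _ (C.h_left t ht x hx') _ hx'
    · have hx' : x ∈ Set.Icc F.c F.b := ⟨hc, hx.2⟩
      exact expand_lower F.c F.b F.κ F.Um F.subUm F.f F.fm F.fm_eq
        (F.fm_smooth.differentiableOn hr1) F.fm_exp _ (C.h_right t ht x hx') _ hx'
  have h2 := C.f_close t ht (C.h t x) ((C.h_bij t ht).mapsTo hx)
  rw [C.h_conj t ht x hx] at h2
  have h3 := abs_sub_le (F.f (C.h t x)) (C.h t (F.f x)) (F.f x)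
  linarith

/-- The conjugacies extended by the identity outside the parameter range. -/
def hx (C : ConjFamily r₀ r F ε) (t x : ℝ) : ℝ :=
  if |t| < ε then C.h t x else x

theorem hx_of_lt (C : ConjFamily r₀ r F ε) (t x : ℝ) (ht : |t| < ε) : C.hx t x = C.h t x := by
  simp [hx, ht]

theorem hx_mem (C : ConjFamily r₀ r F ε) (t x : ℝ) (h : x ∈ Set.Icc F.a F.b) :
    C.hx t x ∈ Set.Icc F.a F.b := by
  unfold hx
  split_ifs with ht
  · exact (C.h_bij t ht).mapsTo h
  · exact h

/-- The curve of conjugacies in the space of bounded functions. -/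
def H (C : ConjFamily r₀ r F ε) (t : ℝ) : DiscI F.a F.b →ᵇ ℝ :=
  BoundedContinuousFunction.ofNormedAddCommGroup (fun x => C.hx t x.1)
    continuous_of_discreteTopology (max |F.a| |F.b|)
    (fun x => abs_le_max_abs_abs (C.hx_mem t x.1 x.2).1 (C.hx_mem t x.1 x.2).2)

theorem H_apply (C : ConjFamily r₀ r F ε) (t : ℝ) (x : DiscI F.a F.b) :
    C.H t x = C.hx t x.1 := rfl

end ConjFamily

/-- The identity as a bounded function. -/
def idB (a b : ℝ) : DiscI a b →ᵇ ℝ :=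
  BoundedContinuousFunction.ofNormedAddCommGroup (fun x => x.1)
    continuous_of_discreteTopology (max |a| |b|)
    (fun x => abs_le_max_abs_abs x.2.1 x.2.2)

theorem idB_apply (a b : ℝ) (x : DiscI a b) : idB a b x = x.1 := rfl

/-- Bounded indicator functions. -/
def indB (a b c : ℝ) (p q : ℝ) : DiscI a b →ᵇ ℝ :=
  BoundedContinuousFunction.ofNormedAddCommGroup (fun x => if x.1 ≤ c then p else q)
    continuous_of_discreteTopology (max |p| |q|)
    (fun x => by
      split_ifs
      · exact le_max_left _ _
      · exact le_max_right _ _)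

theorem indB_left (a b c p q : ℝ) (x : DiscI a b) (h : x.1 ≤ c) : indB a b c p q x = p := if_pos h

theorem indB_right (a b c p q : ℝ) (x : DiscI a b) (h : ¬ x.1 ≤ c) : indB a b c p q x = q :=
  if_neg h

theorem ConjFamily.H_close {r₀ r : ℕ} {F : PWUnimodal r} {ε : ℝ} (C : ConjFamily r₀ r F ε)
    (hr : r ≠ 0) (t : ℝ) (ht : |t| < ε) :
    dist (C.H t) (idB F.a F.b) ≤ C.Cb / (F.κ - 1) * |t| := by
  have hκ := F.one_lt_κ
  have hκ0 : 0 < F.κ := by linarith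
  have hCb : 0 ≤ C.Cb * |t| :=
    (abs_nonneg _).trans (C.f_close t ht F.c ⟨F.hac.le, F.hcb.le⟩)
  rw [dist_eq_norm]
  have h1 : ‖C.H t - idB F.a F.b‖ ≤ (‖C.H t - idB F.a F.b‖ + C.Cb * |t|) / F.κ := by
    refine (BoundedContinuousFunction.norm_le (by positivity)).2 fun x => ?_
    rw [le_div_iff₀ hκ0]
    have h2 := C.h_estimate hr t ht x.1 x.2
    have h3 := (C.H t - idB F.a F.b).norm_coe_le_norm ⟨F.f x.1, F.mapsI x.2⟩
    rw [BoundedContinuousFunction.sub_apply, C.H_apply, idB_apply, C.hx_of_lt t _ ht,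
      Real.norm_eq_abs] at h3
    rw [BoundedContinuousFunction.sub_apply, C.H_apply, idB_apply, C.hx_of_lt t _ ht,
      Real.norm_eq_abs]
    dsimp only at h3
    linarith
  rw [le_div_iff₀ hκ0] at h1
  rw [div_mul_eq_mul_div, le_div_iff₀ (by linarith)]
  linarith

theorem ConjFamily.H_zero {r₀ r : ℕ} {F : PWUnimodal r} {ε : ℝ} (C : ConjFamily r₀ r F ε)
    (hr : r ≠ 0) : C.H 0 = idB F.a F.b := by
  have := C.H_close hr 0 (by simpa using C.εpos)
  rw [abs_zero, mul_zero] at this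
  exact dist_le_zero.1 this

theorem ConjFamily.H_contDiffAt {r₀ : ℕ} {F : PWUnimodal r₀} {ε : ℝ} (C : ConjFamily r₀ r₀ F ε)
    (hr : r₀ ≠ 0) : ContDiffAt ℝ r₀ C.H 0 := by
  have hr1 : (r₀ : WithTop ℕ∞) ≠ 0 := by exact_mod_cast hr
  obtain ⟨Gp, hGp, hsp, δp, hδp, hp⟩ := exists_cutoff r₀ (Set.Icc F.a F.c) isCompact_Icc
    C.Wp C.openWp C.subWp C.Gp C.smoothGp
  obtain ⟨Gm, hGm, hsm, δm, hδm, hm⟩ := exists_cutoff r₀ (Set.Icc F.c F.b) isCompact_Icc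
    C.Wm C.openWm C.subWm C.Gm C.smoothGm
  have hε := C.εpos
  have h0 : |(0:ℝ)| < ε := by simpa using hε
  have hGp0 : ∀ x ∈ Set.Icc F.a F.c, Gp (x, 0) = F.fp x := fun x hx => by
    have h1 := hp x hx 0 (by simpa using hδp)
    rw [h1.2, C.Gp_eq 0 h0 x hx h1.1, C.at0, F.fp_eq hx]
  have hGm0 : ∀ x ∈ Set.Icc F.c F.b, Gm (x, 0) = F.fm x := fun x hx => by
    have h1 := hm x hx 0 (by simpa using hδm)
    rw [h1.2, C.Gm_eq 0 h0 x hx h1.1, C.at0, F.fm_eq hx]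
  have hnear : ∀ δ : ℝ, 0 < δ → ∀ᶠ t : ℝ in 𝓝 0, |t| < δ := fun δ hδ => by
    filter_upwards [Metric.ball_mem_nhds (0:ℝ) hδ] with t ht
    simpa using ht
  refine implicit_motion r₀ hr Gp Gm hGp hGm hsp hsm (indB F.a F.b F.c 1 0) (indB F.a F.b F.c 0 1)
    (fun x => ⟨F.f x.1, F.mapsI x.2⟩) (idB F.a F.b) F.κ F.one_lt_κ ?_ C.H (C.H_zero hr) ?_ ?_
  · intro x
    rw [idB_apply]
    by_cases hc : x.1 ≤ F.c
    · have hx : x.1 ∈ Set.Icc F.a F.c := ⟨x.2.1, hc⟩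
      rw [indB_left _ _ _ _ _ x hc, indB_left _ _ _ _ _ x hc, one_mul, zero_mul, add_zero,
        partial_deriv_eq F.a F.c F.hac F.fp F.Up F.openUp F.subUp
          (F.fp_smooth.differentiableOn hr1) Gp (hGp.differentiable hr1) hGp0 _ hx]
      exact F.fp_exp _ (F.subUp hx)
    · have hx : x.1 ∈ Set.Icc F.c F.b := ⟨(not_le.1 hc).le, x.2.2⟩
      rw [indB_right _ _ _ _ _ x hc, indB_right _ _ _ _ _ x hc, one_mul, zero_mul, zero_add,
        partial_deriv_eq F.c F.b F.hcb F.fm F.Um F.openUm F.subUm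
          (F.fm_smooth.differentiableOn hr1) Gm (hGm.differentiable hr1) hGm0 _ hx]
      exact F.fm_exp _ (F.subUm hx)
  · rw [tendsto_iff_dist_tendsto_zero]
    have hlim : Tendsto (fun t : ℝ => C.Cb / (F.κ - 1) * |t|) (𝓝 0) (𝓝 0) := by
      have : Continuous (fun t : ℝ => C.Cb / (F.κ - 1) * |t|) := by fun_prop
      simpa using this.tendsto 0
    refine squeeze_zero' (Eventually.of_forall fun t => dist_nonneg) ?_ hlim
    filter_upwards [hnear ε hε] with t ht
    exact C.H_close hr t ht
  · filter_upwards [hnear ε hε, hnear δp hδp, hnear δm hδm] with t ht htp htm x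
    rw [C.H_apply, C.H_apply, C.hx_of_lt t _ ht, C.hx_of_lt t _ ht]
    dsimp only
    rw [← C.h_conj t ht x.1 x.2]
    by_cases hc : x.1 ≤ F.c
    · have hx := C.h_left t ht x.1 ⟨x.2.1, hc⟩
      have h1 := hp _ hx t htp
      rw [indB_left _ _ _ _ _ x hc, indB_left _ _ _ _ _ x hc, one_mul, zero_mul, add_zero, h1.2,
        C.Gp_eq t ht _ hx h1.1]
    · have hx := C.h_right t ht x.1 ⟨(not_le.1 hc).le, x.2.2⟩
      have h1 := hm _ hx t htm
      rw [indB_right _ _ _ _ _ x hc, indB_right _ _ _ _ _ x hc, one_mul, zero_mul, zero_add, h1.2,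
        C.Gm_eq t ht _ hx h1.1]

/-- Proposition 2.4, smooth motions. If `f̃_t` is a `C^{r₀,r₀}` perturbation
of a piecewise expanding `C^{r₀}` unimodal map `f`, conjugated to `f` by homeomorphisms `h_t`
fixing `c`, then for small enough `ε'` the map `(t,x) ↦ h_t(x)` is continuous on
`(-ε',ε') × I` and `t ↦ h_t(x)` is `C^{r₀-1+Lip}` on `[-ε',ε']`, uniformly in `x ∈ I`. -/
theorem stmt_1 (r₀ : ℕ) (hr₀ : 2 ≤ r₀) (F : PWUnimodal r₀) (ε : ℝ)
    (C : ConjFamily r₀ r₀ F ε) :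
    ∃ ε' : ℝ, 0 < ε' ∧ ε' ≤ ε ∧
      ContinuousOn (fun p : ℝ × ℝ => C.h p.1 p.2)
        ((Set.Ioo (-ε') ε') ×ˢ (Set.Icc F.a F.b)) ∧
      ∃ M : NNReal, ∀ x ∈ Set.Icc F.a F.b,
        ContDiffOn ℝ (r₀ - 1) (fun t => C.h t x) (Set.Icc (-ε') ε') ∧
        (∀ i ≤ r₀ - 1, ∀ t ∈ Set.Icc (-ε') ε',
          |iteratedDerivWithin i (fun u => C.h u x) (Set.Icc (-ε') ε') t| ≤ M) ∧
        LipschitzOnWith M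
          (iteratedDerivWithin (r₀ - 1) (fun u => C.h u x) (Set.Icc (-ε') ε'))
          (Set.Icc (-ε') ε') := by
  obtain ⟨ε', hepos, helt, hcont, M, hM⟩ := post_bounds r₀ (by omega) C.H
    (C.H_contDiffAt (by omega)) ε C.εpos
  have hlt : ∀ t ∈ Set.Icc (-ε') ε', |t| < ε := fun t ht => (abs_le.2 ht).trans_lt helt
  refine ⟨ε', hepos, helt.le, ?_, M, ?_⟩
  · rintro ⟨t, x⟩ ⟨ht, hx⟩
    have htI : t ∈ Set.Icc (-ε') ε' := Set.Ioo_subset_Icc_self ht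
    rw [Metric.continuousWithinAt_iff]
    intro η hη
    obtain ⟨δ₁, hδ₁, h1⟩ := Metric.continuousWithinAt_iff.1 (hcont t htI) (η / 2) (half_pos hη)
    obtain ⟨δ₂, hδ₂, h2⟩ := Metric.continuousWithinAt_iff.1
      (C.h_cont t (hlt t htI) x hx) (η / 2) (half_pos hη)
    refine ⟨min δ₁ δ₂, lt_min hδ₁ hδ₂, ?_⟩
    rintro ⟨s, y⟩ ⟨hs, hy⟩ hd
    have hsI : s ∈ Set.Icc (-ε') ε' := Set.Ioo_subset_Icc_self hs
    rw [Prod.dist_eq, max_lt_iff] at hd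
    have h3 := h1 hsI (hd.1.trans_le (min_le_left _ _))
    have h4 := h2 hy (hd.2.trans_le (min_le_right _ _))
    have h5 := (BoundedContinuousFunction.dist_coe_le_dist (f := C.H s) (g := C.H t)
      (⟨y, hy⟩ : DiscI F.a F.b)).trans_lt h3
    rw [C.H_apply, C.H_apply, C.hx_of_lt _ _ (hlt s hsI), C.hx_of_lt _ _ (hlt t htI)] at h5
    refine (dist_triangle _ (C.h t y) _).trans_lt ?_
    dsimp only at h5 ⊢
    linarith
  · intro x hx
    obtain ⟨g1, g2, g3⟩ := hM (⟨x, hx⟩ : DiscI F.a F.b)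
    have hE : Set.EqOn (fun u => C.h u x) (fun u => C.H u (⟨x, hx⟩ : DiscI F.a F.b))
        (Set.Icc (-ε') ε') := fun u hu => by
      dsimp only
      rw [C.H_apply, C.hx_of_lt _ _ (hlt u hu)]
    have hI : ∀ i, Set.EqOn (iteratedDerivWithin i (fun u => C.h u x) (Set.Icc (-ε') ε'))
        (iteratedDerivWithin i (fun u => C.H u (⟨x, hx⟩ : DiscI F.a F.b)) (Set.Icc (-ε') ε'))
        (Set.Icc (-ε') ε') := fun i => iteratedDerivWithin_congr hE
    refine ⟨(g1.of_le ?_).congr hE, fun i hi t ht => ?_, ?_⟩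
    · exact tsub_le_self
    · rw [hI i ht]
      exact g2 i hi t ht
    · intro s hs t ht
      rw [hI _ hs, hI _ ht]
      exact g3 hs ht

end
end

section
/- Let r₀ ≥ 2 be an integer and let f̃_t be a C^{r₀,r₀} perturbation of a piecewise expanding C^{r₀} unimodal map f such that for each small t there exists a homeomorphism h_t of I with h_t(c) = c and f̃_t = h_t ∘ f ∘ h_t^{-1}. Then the bounded function α : I → ℝ defined by α(x) = ∂_t h_t(x)|_{t=0} satisfies the twisted cohomological equation v(x) = α(f(x)) − f'(x)·α(x) for all x ≠ c, where v = ∂_t f̃_t|_{t=0}. Moreover α is continuous, α(c) = 0, v(c) = α(c₁), and consequently v is horizontal for f. -/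
open Set MeasureTheory Filter Topology

noncomputable section

/-- bounded real function along an ultrafilter converges -/
theorem uf_lim_aux {β : Type*} (U : Ultrafilter β) (g : β → ℝ) (K : ℝ)
    (h : ∀ᶠ y in (U : Filter β), |g y| ≤ K) :
    ∃ e, |e| ≤ K ∧ Tendsto g U (𝓝 e) := by
  have hm : Set.Icc (-K) K ∈ U.map g :=
    Ultrafilter.mem_map.2 (Filter.Eventually.mono h fun y hy => abs_le.1 hy)
  obtain ⟨e, he, hle⟩ := isCompact_Icc.ultrafilter_le_nhds' (U.map g) hm
  exact ⟨e, abs_le.2 he, hle⟩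

theorem zero_of_pow_bound_aux {κ x M : ℝ} (hκ : 1 < κ) (h : ∀ n : ℕ, κ ^ n * |x| ≤ M) :
    x = 0 := by
  by_contra hx
  have hpos : 0 < |x| := abs_pos.2 hx
  obtain ⟨n, hn⟩ := pow_unbounded_of_one_lt (M / |x|) hκ
  have := h n
  rw [div_lt_iff₀ hpos] at hn
  linarith

/-- The abstract core. -/
theorem core_aux (I : Set ℝ) (f : ℝ → ℝ) (q : ℝ → ℝ → ℝ) (K κ : ℝ) (hκ : 1 < κ)
    (S : Bool → Set ℝ) (D V : Bool → ℝ → ℝ)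
    (hf : ContinuousOn f I) (hmaps : Set.MapsTo f I I)
    (hS : ∀ i, IsClosed (S i)) (hSI : ∀ i, S i ⊆ I) (hcov : ∀ x ∈ I, ∃ i, x ∈ S i)
    (hD : ∀ i, ContinuousOn (D i) (S i)) (hV : ∀ i, ContinuousOn (V i) (S i))
    (hDκ : ∀ i, ∀ x ∈ S i, κ ≤ |D i x|)
    (hq : ∀ᶠ t in 𝓝[≠] (0:ℝ), ∀ x ∈ I, |q t x| ≤ K)
    (hlim : ∀ i, ∀ x ∈ S i,
      Tendsto (fun t => q t (f x) - D i x * q t x) (𝓝[≠] 0) (𝓝 (V i x))) :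
    ∃ α : ℝ → ℝ, (∀ x ∈ I, Tendsto (fun t => q t x) (𝓝[≠] 0) (𝓝 (α x))) ∧
      (∀ x ∈ I, |α x| ≤ K) ∧ ContinuousOn α I ∧
      ∀ i, ∀ x ∈ S i, V i x = α (f x) - D i x * α x := by
  have hκ0 : 0 < κ := by linarith
  -- limits along ultrafilters
  have key : ∀ U : Ultrafilter ℝ, (U : Filter ℝ) ≤ 𝓝[≠] 0 → ∃ A : ℝ → ℝ,
      (∀ x ∈ I, |A x| ≤ K ∧ Tendsto (fun t => q t x) U (𝓝 (A x))) ∧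
      ∀ i, ∀ x ∈ S i, V i x = A (f x) - D i x * A x := by
    intro U hU
    have h1 : ∀ x, ∃ e, x ∈ I → |e| ≤ K ∧ Tendsto (fun t => q t x) U (𝓝 e) := by
      intro x
      by_cases hx : x ∈ I
      · obtain ⟨e, he⟩ := uf_lim_aux U (fun t => q t x) K
          (Filter.Eventually.mono (hU hq) fun t ht => ht x hx)
        exact ⟨e, fun _ => he⟩
      · exact ⟨0, fun h => absurd h hx⟩
    choose A hA using h1
    refine ⟨A, hA, fun i x hx => ?_⟩
    have h2 := (hlim i x hx).mono_left hU
    have h3 := (hA (f x) (hmaps (hSI i hx))).2.sub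
      ((hA x (hSI i hx)).2.const_mul (D i x))
    exact tendsto_nhds_unique h2 h3
  have uniq : ∀ A B : ℝ → ℝ, (∀ x ∈ I, |A x| ≤ K) → (∀ x ∈ I, |B x| ≤ K) →
      (∀ i, ∀ x ∈ S i, V i x = A (f x) - D i x * A x) →
      (∀ i, ∀ x ∈ S i, V i x = B (f x) - D i x * B x) → ∀ x ∈ I, A x = B x := by
    intro A B hA hB eA eB
    have h : ∀ n : ℕ, ∀ x ∈ I, κ ^ n * |A x - B x| ≤ 2 * K := by
      intro n
      induction n with
      | zero =>
        intro x hx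
        have := abs_sub (A x) (B x)
        have := hA x hx
        have := hB x hx
        simp only [pow_zero, one_mul]; linarith
      | succ n ih =>
        intro x hx
        obtain ⟨i, hi⟩ := hcov x hx
        have h1 := ih (f x) (hmaps hx)
        have h2 : A (f x) - B (f x) = D i x * (A x - B x) := by
          have := eA i x hi
          have := eB i x hi
          linarith
        rw [h2, abs_mul] at h1
        have h3 := hDκ i x hi
        have : κ ^ (n+1) * |A x - B x| ≤ κ ^ n * (|D i x| * |A x - B x|) := by
          rw [pow_succ, mul_assoc]
          gcongr
        linarith
    intro x hx
    exact sub_eq_zero.1 (zero_of_pow_bound_aux hκ fun n => h n x hx)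
  obtain ⟨α, hα, eα⟩ := key (Ultrafilter.of (𝓝[≠] (0:ℝ))) (Ultrafilter.of_le _)
  have hb : ∀ x ∈ I, |α x| ≤ K := fun x hx => (hα x hx).1
  refine ⟨α, ?_, hb, ?_, eα⟩
  · intro x hx
    rw [tendsto_iff_ultrafilter]
    intro U hU
    obtain ⟨A, hA, eA⟩ := key U hU
    rw [uniq α A hb (fun x hx => (hA x hx).1) eα eA x hx]
    exact (hA x hx).2
  · have h : ∀ n : ℕ, ∀ x ∈ I, ∀ U : Ultrafilter ℝ, (U : Filter ℝ) ≤ 𝓝[I] x → ∀ e,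
        Tendsto α U (𝓝 e) → κ ^ n * |e - α x| ≤ 2 * K := by
      intro n
      induction n with
      | zero =>
        intro x hx U hU e he
        have hU' : ∀ᶠ y in (U : Filter ℝ), y ∈ I := hU self_mem_nhdsWithin
        have h1 : |e| ≤ K := le_of_tendsto he.abs (hU'.mono fun y hy => hb y hy)
        have := abs_sub e (α x)
        have := hb x hx
        simp only [pow_zero, one_mul]; linarith
      | succ n ih =>
        intro x hx U hU e he
        have hU' : ∀ᶠ y in (U : Filter ℝ), y ∈ I := hU self_mem_nhdsWithin
        have h0 : ∀ᶠ y in (U : Filter ℝ), y ∈ S true ∨ y ∈ S false := by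
          filter_upwards [hU'] with y hy
          obtain ⟨i, hi⟩ := hcov y hy
          cases i
          · exact Or.inr hi
          · exact Or.inl hi
        have h1 : ∃ i, ∀ᶠ y in (U : Filter ℝ), y ∈ S i := by
          rcases Ultrafilter.eventually_or.1 h0 with h | h
          exacts [⟨_, h⟩, ⟨_, h⟩]
        obtain ⟨i, hi⟩ := h1
        have hUx : (U : Filter ℝ) ≤ 𝓝 x := hU.trans nhdsWithin_le_nhds
        have hxi : x ∈ S i := (hS i).mem_of_tendsto (f := id) (b := (U : Filter ℝ)) hUx hi
        have hUi : (U : Filter ℝ) ≤ 𝓝[S i] x := le_inf hUx (le_principal_iff.2 hi)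
        have tD : Tendsto (D i) U (𝓝 (D i x)) := (hD i x hxi).mono_left hUi
        have tV : Tendsto (V i) U (𝓝 (V i x)) := (hV i x hxi).mono_left hUi
        have tf : Tendsto α (U.map f) (𝓝 (V i x + D i x * e)) := by
          have : Tendsto (α ∘ f) U (𝓝 (V i x + D i x * e)) := by
            refine (tV.add (tD.mul he)).congr' ?_
            filter_upwards [hi] with y hy
            have := eα i y hy
            simp only [Function.comp]; linarith
          exact this
        have hfU : ((U.map f : Ultrafilter ℝ) : Filter ℝ) ≤ 𝓝[I] (f x) := by
          have h5 : Tendsto f U (𝓝 (f x)) := (hf x hx).mono_left hU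
          exact le_inf h5 (le_principal_iff.2 (hU'.mono fun y hy => hmaps hy))
        have h1 := ih (f x) (hmaps hx) (U.map f) hfU _ tf
        have h2 : V i x + D i x * e - α (f x) = D i x * (e - α x) := by
          have := eα i x hxi
          linarith
        rw [h2, abs_mul] at h1
        have h3 := hDκ i x hxi
        have : κ ^ (n+1) * |e - α x| ≤ κ ^ n * (|D i x| * |e - α x|) := by
          rw [pow_succ, mul_assoc]
          gcongr
        linarith
    intro x hx
    rw [ContinuousWithinAt, tendsto_iff_ultrafilter]
    intro U hU
    obtain ⟨e, -, he⟩ := uf_lim_aux U α K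
      (Filter.Eventually.mono (hU self_mem_nhdsWithin) fun y hy => hb y hy)
    have : e - α x = 0 := zero_of_pow_bound_aux hκ fun n => h n x hx U hU e he
    rw [sub_eq_zero.1 this] at he
    exact he

/-- One-sided data. -/
theorem side_aux (l u : ℝ) (hlu : l < u) (G : ℝ × ℝ → ℝ) (W : Set (ℝ × ℝ)) (n : ℕ) (hn : 1 ≤ n)
    (hW : IsOpen W) (hsub : (Set.Icc l u) ×ˢ ({0} : Set ℝ) ⊆ W) (hG : ContDiffOn ℝ n G W)
    (g : ℝ → ℝ) (Ug : Set ℝ) (hUg : IsOpen Ug) (hsubg : Set.Icc l u ⊆ Ug)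
    (hg : ContDiffOn ℝ n g Ug) (hgG : ∀ x ∈ Set.Icc l u, G (x, 0) = g x) :
    ContinuousOn (deriv g) (Set.Icc l u) ∧
    ContinuousOn (fun x => deriv (fun t => G (x, t)) 0) (Set.Icc l u) ∧
    ∀ (h : ℝ → ℝ → ℝ) (K x : ℝ), x ∈ Set.Icc l u → 
      (∀ᶠ t in 𝓝[≠] (0:ℝ), |h t x - x| ≤ K * |t|) →
      (∀ᶠ t in 𝓝[≠] (0:ℝ), (h t x, t) ∈ W → G (h t x, t) = h t (g x)) →
      Tendsto (fun t => (h t (g x) - g x) / t - deriv g x * ((h t x - x) / t)) (𝓝[≠] 0)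
        (𝓝 (deriv (fun t => G (x, t)) 0)) := by
  have hn' : (1 : WithTop ℕ∞) ≤ n := by exact_mod_cast hn
  have hn0 : (n : WithTop ℕ∞) ≠ 0 := by
    intro h0
    have : n = 0 := by exact_mod_cast h0
    omega
  have hmem : ∀ x ∈ Set.Icc l u, (x, (0:ℝ)) ∈ W := fun x hx => hsub ⟨hx, rfl⟩
  have hGd : ∀ x ∈ Set.Icc l u, HasFDerivAt G (fderiv ℝ G (x, 0)) (x, 0) := fun x hx =>
    ((hG.differentiableOn hn0).differentiableAt
      (hW.mem_nhds (hmem x hx))).hasFDerivAt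
  have hV : ∀ x ∈ Set.Icc l u, deriv (fun t => G (x, t)) 0 = fderiv ℝ G (x, 0) (0, 1) := by
    intro x hx
    have h1 : HasDerivAt (fun t : ℝ => (x, t)) ((0:ℝ), (1:ℝ)) 0 :=
      (hasDerivAt_const (0:ℝ) x).prodMk (hasDerivAt_id (0:ℝ))
    exact ((hGd x hx).comp_hasDerivAt (0:ℝ) h1).deriv
  have hD : ∀ x ∈ Set.Icc l u, deriv g x = fderiv ℝ G (x, 0) (1, 0) := by
    intro x hx
    have h1 : HasDerivAt (fun y : ℝ => (y, (0:ℝ))) ((1:ℝ), (0:ℝ)) x :=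
      (hasDerivAt_id x).prodMk (hasDerivAt_const x (0:ℝ))
    have h2 : HasDerivWithinAt (fun y => G (y, 0)) (fderiv ℝ G (x, 0) (1, 0)) (Set.Icc l u) x :=
      ((hGd x hx).comp_hasDerivAt x h1).hasDerivWithinAt
    have h3 : HasDerivWithinAt g (deriv g x) (Set.Icc l u) x :=
      ((hg.differentiableOn hn0).differentiableAt
        (hUg.mem_nhds (hsubg hx))).hasDerivAt.hasDerivWithinAt
    have h4 := h3.congr (fun y hy => hgG y hy) (hgG x hx)
    exact (uniqueDiffOn_Icc hlu x hx).eq_deriv _ h4 h2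
  have hfc : ContinuousOn (fderiv ℝ G) W := hG.continuousOn_fderiv_of_isOpen hW hn'
  have hfc' : ContinuousOn (fun x : ℝ => fderiv ℝ G (x, 0)) (Set.Icc l u) :=
    hfc.comp (by fun_prop) (fun x hx => hmem x hx)
  refine ⟨(hg.continuousOn_deriv_of_isOpen hUg hn').mono hsubg, ?_, ?_⟩
  · exact (hfc'.clm_apply continuousOn_const).congr hV
  · intro h K x hx hK hc
    have ht0 : Tendsto (fun t : ℝ => t) (𝓝[≠] 0) (𝓝 0) := nhdsWithin_le_nhds
    have hO : (fun t => h t x - x) =O[𝓝[≠] 0] (fun t : ℝ => t) := by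
      refine Asymptotics.IsBigO.of_bound K ?_
      filter_upwards [hK] with t ht
      simpa using ht
    have hx0 : Tendsto (fun t => h t x) (𝓝[≠] 0) (𝓝 x) := by
      have := (hO.trans_tendsto ht0).add_const x
      simpa using this
    have hp : Tendsto (fun t => (h t x, t)) (𝓝[≠] 0) (𝓝 (x, 0)) := hx0.prodMk_nhds ht0
    have hl := (hGd x hx).isLittleO.comp_tendsto hp
    have hO2 : ((fun p : ℝ × ℝ => p - (x, 0)) ∘ fun t => (h t x, t)) =O[𝓝[≠] 0]
        (fun t : ℝ => t) := by
      have : ((fun p : ℝ × ℝ => p - (x, 0)) ∘ fun t => (h t x, t)) =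
          fun t => (h t x - x, t) := by
        funext t; simp
      rw [this]
      exact hO.prod_left (Asymptotics.isBigO_refl _ _)
    have hl2 := (hl.trans_isBigO hO2).tendsto_div_nhds_zero
    have hl3 := hl2.add_const (fderiv ℝ G (x, 0) (0, 1))
    rw [zero_add, ← hV x hx] at hl3
    refine hl3.congr' ?_
    filter_upwards [hc, hp (hW.mem_nhds (hmem x hx)), self_mem_nhdsWithin] with t h1 h2 h3
    have h3' : t ≠ 0 := h3
    have e1 := h1 h2
    have e2 : ((h t x, t) : ℝ × ℝ) - (x, 0) = (h t x - x) • ((1:ℝ), (0:ℝ)) + t • ((0:ℝ), (1:ℝ)) := by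
      ext <;> simp
    simp only [Function.comp, e1, e2, map_add, map_smul, ← hD x hx, ← hV x hx, hgG x hx, smul_eq_mul]
    field_simp
    ring

theorem expand_aux (l u κ δ : ℝ) (g gt : ℝ → ℝ) (Vs : Set ℝ)
    (hsub : Set.Icc l u ⊆ Vs)
    (hg : ∀ x ∈ Vs, DifferentiableAt ℝ g x) (hgt : ∀ x ∈ Vs, DifferentiableAt ℝ gt x)
    (hκ : ∀ x ∈ Vs, κ ≤ |deriv g x|)
    (hcl : ∀ x ∈ Vs, |iteratedDeriv 1 (fun y => g y - gt y) x| ≤ δ)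
    {x y : ℝ} (hx : x ∈ Set.Icc l u) (hy : y ∈ Set.Icc l u) :
    (κ - δ) * |y - x| ≤ |gt y - gt x| := by
  have hd : ∀ z ∈ Set.Icc l u, κ - δ ≤ |deriv gt z| := by
    intro z hz
    have h1 := hcl z (hsub hz)
    have e : deriv (fun y => g y - gt y) z = deriv g z - deriv gt z :=
      ((hg z (hsub hz)).hasDerivAt.sub (hgt z (hsub hz)).hasDerivAt).deriv
    rw [iteratedDeriv_one, e] at h1
    have h2 := hκ z (hsub hz)
    have h3 := abs_sub_abs_le_abs_sub (deriv g z) (deriv gt z)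
    linarith
  have main : ∀ x ∈ Set.Icc l u, ∀ y ∈ Set.Icc l u, x < y →
      (κ - δ) * |y - x| ≤ |gt y - gt x| := by
    intro x hx y hy hxy
    have hss : Set.Icc x y ⊆ Set.Icc l u := Set.Icc_subset_Icc hx.1 hy.2
    obtain ⟨z, hz, hz'⟩ := exists_deriv_eq_slope gt hxy
      (fun w hw => (hgt w (hsub (hss hw))).continuousAt.continuousWithinAt)
      (fun w hw => (hgt w (hsub (hss (Set.Ioo_subset_Icc_self hw)))).differentiableWithinAt)
    have h1 := hd z (hss (Set.Ioo_subset_Icc_self hz))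
    have hne : y - x ≠ 0 := sub_ne_zero.2 hxy.ne'
    have h2 : gt y - gt x = deriv gt z * (y - x) := by
      rw [hz']; field_simp
    rw [h2, abs_mul]
    gcongr
  rcases lt_trichotomy x y with h | h | h
  · exact main x hx y hy h
  · subst h; simp
  · have := main y hy x hx h
    rwa [abs_sub_comm y x, abs_sub_comm (gt y) (gt x)]

theorem conj_side_aux {r₀ : ℕ} {F : PWUnimodal r₀} {ε : ℝ}
    (C : ConjFamily r₀ r₀ F ε) (t : ℝ) (ht : |t| < ε) :
    (∀ x ∈ Set.Icc F.a F.c, C.h t x ∈ Set.Icc F.a F.c) ∧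
    (∀ x ∈ Set.Icc F.c F.b, C.h t x ∈ Set.Icc F.c F.b) := by
  have hac := F.hac
  have hcb := F.hcb
  have hb := C.h_bij t ht
  have hmaps := hb.mapsTo
  have ha : F.a ∈ Set.Icc F.a F.b := ⟨le_rfl, by linarith⟩
  have hc : F.c ∈ Set.Icc F.a F.b := ⟨by linarith, by linarith⟩
  have hbb : F.b ∈ Set.Icc F.a F.b := ⟨by linarith, le_rfl⟩
  have hm : StrictMonoOn (C.h t) (Set.Icc F.a F.b) := by
    rcases ContinuousOn.strictMonoOn_of_injOn_Icc' (by linarith) (C.h_cont t ht) hb.injOn with h | h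
    · exact h
    · exfalso
      obtain ⟨y, hy, hyb⟩ := hb.surjOn hbb
      have h1 := h.antitoneOn ha hy hy.1
      have h2 := (hmaps ha).2
      have h3 : C.h t F.a = F.b := by linarith
      have h4 := C.h_conj t ht F.a ha
      rw [F.fa, h3] at h4
      have h5 := (C.fam t).fb
      rw [C.same_b, C.same_a, h4] at h5
      linarith
  refine ⟨fun x hx => ?_, fun x hx => ?_⟩
  · have hxI : x ∈ Set.Icc F.a F.b := ⟨hx.1, by linarith [hx.2]⟩
    have := hm.monotoneOn hxI hc hx.2
    rw [C.h_c t ht] at this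
    exact ⟨(hmaps hxI).1, this⟩
  · have hxI : x ∈ Set.Icc F.a F.b := ⟨by linarith [hx.1], hx.2⟩
    have := hm.monotoneOn hc hxI hx.1
    rw [C.h_c t ht] at this
    exact ⟨this, (hmaps hxI).2⟩

theorem conj_bound_aux {r₀ : ℕ} (hr₀ : 2 ≤ r₀) {F : PWUnimodal r₀} {ε : ℝ}
    (C : ConjFamily r₀ r₀ F ε) (t : ℝ) (ht : |t| < ε) (hs : C.Cb * |t| ≤ (F.κ - 1) / 2)
    (x : ℝ) (hx : x ∈ Set.Icc F.a F.b) :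
    |C.h t x - x| ≤ (2 * C.Cb / (F.κ - 1)) * |t| := by
  have hac := F.hac
  have hcb := F.hcb
  have hκ := F.one_lt_κ
  have hr0 : (r₀ : WithTop ℕ∞) ≠ 0 := by
    intro h0
    have : r₀ = 0 := by exact_mod_cast h0
    omega
  have h00 : |(0:ℝ)| < ε := by simpa using C.εpos
  have hVU0 : C.Vp ⊆ F.Up := by have := C.VpUp 0 h00; rwa [C.at0] at this
  have hVM0 : C.Vm ⊆ F.Um := by have := C.VmUm 0 h00; rwa [C.at0] at this
  obtain ⟨sp, sm⟩ := conj_side_aux C t ht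
  have fpeq : ∀ y ∈ Set.Icc F.a F.c, (C.fam t).fp y = (C.fam t).f y := by
    intro y hy
    apply (C.fam t).fp_eq
    rwa [C.same_a, C.same_c]
  have fmeq : ∀ y ∈ Set.Icc F.c F.b, (C.fam t).fm y = (C.fam t).f y := by
    intro y hy
    apply (C.fam t).fm_eq
    rwa [C.same_b, C.same_c]
  have dF : ∀ x ∈ C.Vp, DifferentiableAt ℝ F.fp x := fun x hx =>
    (F.fp_smooth.differentiableOn hr0).differentiableAt (F.openUp.mem_nhds (hVU0 hx))
  have dFm : ∀ x ∈ C.Vm, DifferentiableAt ℝ F.fm x := fun x hx =>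
    (F.fm_smooth.differentiableOn hr0).differentiableAt (F.openUm.mem_nhds (hVM0 hx))
  have dt : ∀ x ∈ C.Vp, DifferentiableAt ℝ (C.fam t).fp x := fun x hx =>
    ((C.fam t).fp_smooth.differentiableOn hr0).differentiableAt
      ((C.fam t).openUp.mem_nhds (C.VpUp t ht hx))
  have dtm : ∀ x ∈ C.Vm, DifferentiableAt ℝ (C.fam t).fm x := fun x hx =>
    ((C.fam t).fm_smooth.differentiableOn hr0).differentiableAt
      ((C.fam t).openUm.mem_nhds (C.VmUm t ht hx))
  have step : ∀ x ∈ Set.Icc F.a F.b,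
      (F.κ - C.Cb * |t|) * |C.h t x - x| ≤ |C.h t (F.f x) - F.f x| + C.Cb * |t| := by
    intro x hx
    rcases le_total x F.c with hxc | hxc
    · have hxs : x ∈ Set.Icc F.a F.c := ⟨hx.1, hxc⟩
      have h1 := expand_aux F.a F.c F.κ (C.Cb * |t|) F.fp (C.fam t).fp C.Vp C.subVp dF dt
        (fun x hx => F.fp_exp x (hVU0 hx)) (C.close_p t ht 1 (by omega)) hxs (sp x hxs)
      rw [fpeq _ hxs, fpeq _ (sp x hxs), C.h_conj t ht x hx] at h1
      have h2 := C.close_p t ht 0 (by omega) x (C.subVp hxs)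
      rw [iteratedDeriv_zero, fpeq _ hxs, F.fp_eq hxs] at h2
      have h3 := abs_add_le (C.h t (F.f x) - F.f x) (F.f x - (C.fam t).f x)
      rw [sub_add_sub_cancel] at h3
      linarith
    · have hxs : x ∈ Set.Icc F.c F.b := ⟨hxc, hx.2⟩
      have h1 := expand_aux F.c F.b F.κ (C.Cb * |t|) F.fm (C.fam t).fm C.Vm C.subVm dFm dtm
        (fun x hx => F.fm_exp x (hVM0 hx)) (C.close_m t ht 1 (by omega)) hxs (sm x hxs)
      rw [fmeq _ hxs, fmeq _ (sm x hxs), C.h_conj t ht x hx] at h1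
      have h2 := C.close_m t ht 0 (by omega) x (C.subVm hxs)
      rw [iteratedDeriv_zero, fmeq _ hxs, F.fm_eq hxs] at h2
      have h3 := abs_add_le (C.h t (F.f x) - F.f x) (F.f x - (C.fam t).f x)
      rw [sub_add_sub_cancel] at h3
      linarith
  have hcont : ContinuousOn (fun x => |C.h t x - x|) (Set.Icc F.a F.b) :=
    ((C.h_cont t ht).sub continuousOn_id).abs
  obtain ⟨m, hm, hmax⟩ := isCompact_Icc.exists_isMaxOn ⟨x, hx⟩ hcont
  have h1 := step m hm
  have h2 : |C.h t (F.f m) - F.f m| ≤ |C.h t m - m| := hmax (F.mapsI hm)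
  have h3 : |C.h t x - x| ≤ |C.h t m - m| := hmax hx
  have h4 := abs_nonneg (C.h t m - m)
  have h5 : |C.h t m - m| * (F.κ - 1) ≤ 2 * C.Cb * |t| := by nlinarith
  have h6 : |C.h t m - m| ≤ 2 * C.Cb * |t| / (F.κ - 1) := by
    rw [le_div_iff₀ (by linarith)]; exact h5
  have h7 : 2 * C.Cb * |t| / (F.κ - 1) = (2 * C.Cb / (F.κ - 1)) * |t| := by ring
  linarith

theorem horizontal_aux {r : ℕ} (F : PWUnimodal r) (v α : ℝ → ℝ) (K : ℝ)
    (hb : ∀ x ∈ Set.Icc F.a F.b, |α x| ≤ K) (hc : α F.c = 0)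
    (he : ∀ x ∈ Set.Icc F.a F.b, v x = α (F.f x) - F.d x * α x) : F.Horizontal v := by
  have hac := F.hac
  have hcb := F.hcb
  have hκ := F.one_lt_κ
  have hcI : F.c ∈ Set.Icc F.a F.b := ⟨by linarith, by linarith⟩
  have hck : ∀ n, F.ck n ∈ Set.Icc F.a F.b := fun n => F.mapsI.iterate n hcI
  have hd : ∀ x ∈ Set.Icc F.a F.b, F.κ ≤ |F.d x| := by
    intro x hx
    unfold PWUnimodal.d
    split_ifs with h
    · exact F.fp_exp x (F.subUp ⟨hx.1, h⟩)
    · exact F.fm_exp x (F.subUm ⟨by linarith, hx.2⟩)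
  have hit : ∀ n, F.f^[n] (F.ck 1) = F.ck (n+1) := by
    intro n
    unfold PWUnimodal.ck
    rw [← Function.iterate_add_apply]
  have hsucc : ∀ n, F.f (F.ck n) = F.ck (n+1) := by
    intro n
    unfold PWUnimodal.ck
    rw [Function.iterate_succ_apply']
  have hdn : ∀ n, F.κ ^ n ≤ |F.dn n (F.ck 1)| := by
    intro n
    induction n with
    | zero => simp [PWUnimodal.dn]
    | succ n ih =>
      have : F.dn (n+1) (F.ck 1) = F.dn n (F.ck 1) * F.d (F.ck (n+1)) := by
        unfold PWUnimodal.dn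
        rw [Finset.prod_range_succ, hit]
      rw [this, abs_mul, pow_succ]
      have := hd _ (hck (n+1))
      gcongr
  have hpos : ∀ n, 0 < |F.dn n (F.ck 1)| := fun n =>
    lt_of_lt_of_le (pow_pos (by linarith) n) (hdn n)
  have hsum : ∀ n, ∑ j ∈ Finset.range (n+1), v (F.ck j) / F.dn j (F.ck 1) =
      α (F.ck (n+1)) / F.dn n (F.ck 1) := by
    intro n
    induction n with
    | zero =>
      have h0 : F.ck 0 = F.c := rfl
      have := he _ (hck 0)
      rw [hsucc, h0, hc] at this
      simp [PWUnimodal.dn, h0, this]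
    | succ n ih =>
      rw [Finset.sum_range_succ, ih, he _ (hck (n+1)), hsucc]
      have e : F.dn (n+1) (F.ck 1) = F.dn n (F.ck 1) * F.d (F.ck (n+1)) := by
        unfold PWUnimodal.dn
        rw [Finset.prod_range_succ, hit]
      have h1 : F.dn n (F.ck 1) ≠ 0 := abs_pos.1 (hpos n)
      have h2 : F.d (F.ck (n+1)) ≠ 0 := by
        have := hd _ (hck (n+1))
        exact abs_pos.1 (by linarith)
      rw [e]
      field_simp
      ring
  constructor
  · rintro ⟨n, hn, hn'⟩
    have hp : 0 < Function.minimalPeriod F.f F.c :=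
      Function.IsPeriodicPt.minimalPeriod_pos hn hn'
    obtain ⟨m, hm⟩ := Nat.exists_eq_succ_of_ne_zero hp.ne'
    have h1 : F.ck (m+1) = F.c := by
      have := Function.isPeriodicPt_minimalPeriod F.f F.c
      rw [hm] at this
      exact this
    rw [hm, Nat.succ_eq_add_one, hsum, h1, hc, zero_div]
  · intro _
    by_cases hS : Summable (fun j : ℕ => v (F.ck j) / F.dn j (F.ck 1))
    · have h1 := (hS.hasSum.tendsto_sum_nat).comp (tendsto_add_atTop_nat 1)
      refine tendsto_nhds_unique h1 ?_
      have h2 : Tendsto (fun n : ℕ => K * (F.κ⁻¹) ^ n) atTop (𝓝 0) := by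
        have := (tendsto_pow_atTop_nhds_zero_of_lt_one (r := F.κ⁻¹)
          (inv_nonneg.2 (by linarith)) (inv_lt_one_of_one_lt₀ hκ)).const_mul K
        simpa using this
      refine squeeze_zero_norm (fun n => ?_) h2
      simp only [Function.comp, hsum, Real.norm_eq_abs, abs_div]
      have hK := hb _ (hck (n+1))
      have hK0 : 0 ≤ K := (abs_nonneg _).trans hK
      rw [inv_pow, ← div_eq_mul_inv]
      exact div_le_div₀ hK0 hK (pow_pos (by linarith) n) (hdn n)
    · exact tsum_eq_zero_of_not_summable hS

/-- Corollary 2.5. For a conjugated `C^{r₀,r₀}` perturbation `f̃_t` of `f`,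
the infinitesimal conjugacy `α(x) = ∂_t h_t(x)|_{t=0}` is bounded and continuous, satisfies
the twisted cohomological equation for `v = ∂_t f̃_t|_{t=0}`, `α(c) = 0`, `v(c) = α(c₁)`, and
`v` is horizontal for `f`. -/
theorem stmt_2 (r₀ : ℕ) (hr₀ : 2 ≤ r₀) (F : PWUnimodal r₀) (ε : ℝ)
    (C : ConjFamily r₀ r₀ F ε) :
    (∃ M, ∀ x ∈ Set.Icc F.a F.b, |C.alpha x| ≤ M) ∧
    ContinuousOn C.alpha (Set.Icc F.a F.b) ∧
    C.alpha F.c = 0 ∧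
    (∀ x ∈ Set.Icc F.a F.b, x ≠ F.c →
      C.toPWFamily.v x = C.alpha (F.f x) - F.d x * C.alpha x) ∧
    C.toPWFamily.v F.c = C.alpha (F.ck 1) ∧
    F.Horizontal C.toPWFamily.v := by
  have hac := F.hac
  have hcb := F.hcb
  have hκ := F.one_lt_κ
  have hcI : F.c ∈ Set.Icc F.a F.b := ⟨by linarith, by linarith⟩
  have h00 : |(0:ℝ)| < ε := by simpa using C.εpos
  have hab0 : Tendsto (fun t : ℝ => |t|) (𝓝[≠] 0) (𝓝 0) := by
    have : Tendsto (fun t : ℝ => |t|) (𝓝 0) (𝓝 |0|) := continuous_abs.tendsto 0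
    rw [abs_zero] at this
    exact this.mono_left nhdsWithin_le_nhds
  have ev1 : ∀ᶠ t in 𝓝[≠] (0:ℝ), |t| < ε := hab0.eventually (gt_mem_nhds C.εpos)
  have ev2 : ∀ᶠ t in 𝓝[≠] (0:ℝ), C.Cb * |t| ≤ (F.κ - 1) / 2 := by
    have h1 := hab0.const_mul C.Cb
    rw [mul_zero] at h1
    filter_upwards [h1.eventually (gt_mem_nhds (show (0:ℝ) < (F.κ - 1) / 2 by linarith))] with t ht
    exact le_of_lt ht
  set K := 2 * C.Cb / (F.κ - 1) with hKdef
  have hbd : ∀ᶠ t in 𝓝[≠] (0:ℝ), ∀ x ∈ Set.Icc F.a F.b, |C.h t x - x| ≤ K * |t| := by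
    filter_upwards [ev1, ev2] with t h1 h2 x hx
    exact conj_bound_aux hr₀ C t h1 h2 x hx
  have hid : ∀ x ∈ Set.Icc F.a F.b, C.h 0 x = x := by
    intro x hx
    have h := conj_bound_aux hr₀ C 0 h00 (by simp; linarith) x hx
    rw [abs_zero, mul_zero] at h
    exact sub_eq_zero.1 (abs_nonpos_iff.1 h)
  obtain ⟨dp, vp, lp⟩ := side_aux F.a F.c hac C.Gp C.Wp r₀ (by omega) C.openWp C.subWp C.smoothGp
    F.fp F.Up F.openUp F.subUp F.fp_smooth (by
      intro x hx
      rw [C.Gp_eq 0 h00 x hx (C.subWp ⟨hx, rfl⟩), C.at0, F.fp_eq hx])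
  obtain ⟨dm, vm, lm⟩ := side_aux F.c F.b hcb C.Gm C.Wm r₀ (by omega) C.openWm C.subWm C.smoothGm
    F.fm F.Um F.openUm F.subUm F.fm_smooth (by
      intro x hx
      rw [C.Gm_eq 0 h00 x hx (C.subWm ⟨hx, rfl⟩), C.at0, F.fm_eq hx])
  have subp : Set.Icc F.a F.c ⊆ Set.Icc F.a F.b := Set.Icc_subset_Icc_right hcb.le
  have subm : Set.Icc F.c F.b ⊆ Set.Icc F.a F.b := Set.Icc_subset_Icc_left hac.le
  obtain ⟨α, hα, hαb, hαc, hαe⟩ := core_aux (Set.Icc F.a F.b) F.f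
    (fun t x => (C.h t x - x) / t) K F.κ hκ
    (fun i => if i then Set.Icc F.a F.c else Set.Icc F.c F.b)
    (fun i => if i then deriv F.fp else deriv F.fm)
    (fun i x => if i then deriv (fun t => C.Gp (x, t)) 0 else deriv (fun t => C.Gm (x, t)) 0)
    F.cont F.mapsI
    (by intro i; cases i <;> simpa using isClosed_Icc)
    (by intro i; cases i <;> simpa)
    (by
      intro x hx
      rcases le_total x F.c with h | h
      · exact ⟨true, by simpa using ⟨hx.1, h⟩⟩
      · exact ⟨false, by simpa using ⟨h, hx.2⟩⟩)
    (by intro i; cases i <;> simpa)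
    (by intro i; cases i <;> simpa)
    (by
      intro i x hx
      cases i
      · simp only [Bool.false_eq_true, if_false] at hx ⊢
        exact F.fm_exp x (F.subUm hx)
      · simp only [if_true] at hx ⊢
        exact F.fp_exp x (F.subUp hx))
    (by
      filter_upwards [hbd, self_mem_nhdsWithin] with t h1 h2 x hx
      have h2' : 0 < |t| := abs_pos.2 h2
      rw [abs_div, div_le_iff₀ h2']
      exact h1 x hx)
    (by
      intro i x hx
      cases i
      · simp only [Bool.false_eq_true, if_false] at hx ⊢
        have := lm C.h K x hx (hbd.mono fun t ht => ht x (subm hx)) (by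
          filter_upwards [ev1] with t ht hW
          rw [C.Gm_eq t ht _ ((conj_side_aux C t ht).2 x hx) hW, C.h_conj t ht x (subm hx),
            F.fm_eq hx])
        rwa [F.fm_eq hx] at this
      · simp only [if_true] at hx ⊢
        have := lp C.h K x hx (hbd.mono fun t ht => ht x (subp hx)) (by
          filter_upwards [ev1] with t ht hW
          rw [C.Gp_eq t ht _ ((conj_side_aux C t ht).1 x hx) hW, C.h_conj t ht x (subp hx),
            F.fp_eq hx])
        rwa [F.fp_eq hx] at this)
  have hA : ∀ x ∈ Set.Icc F.a F.b, C.alpha x = α x := by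
    intro x hx
    have : HasDerivAt (fun t => C.h t x) (α x) 0 := by
      rw [hasDerivAt_iff_tendsto_slope]
      refine (hα x hx).congr fun t => ?_
      rw [slope_def_field, hid x hx, sub_zero]
    exact this.deriv
  have hc0 : C.alpha F.c = 0 := by
    rw [hA _ hcI]
    refine tendsto_nhds_unique (hα _ hcI) (tendsto_const_nhds.congr' ?_)
    filter_upwards [ev1] with t ht
    rw [C.h_c t ht, sub_self, zero_div]
  have heq : ∀ x ∈ Set.Icc F.a F.b,
      C.toPWFamily.v x = C.alpha (F.f x) - F.d x * C.alpha x := by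
    intro x hx
    rw [hA x hx, hA _ (F.mapsI hx)]
    unfold PWFamily.v PWUnimodal.d
    split_ifs with h
    · have := hαe true x (by simpa using ⟨hx.1, h⟩)
      simpa using this
    · have := hαe false x (by simpa using ⟨(not_le.1 h).le, hx.2⟩)
      simpa using this
  have hb : ∀ x ∈ Set.Icc F.a F.b, |C.alpha x| ≤ K := fun x hx => by
    rw [hA x hx]; exact hαb x hx
  refine ⟨⟨K, hb⟩, hαc.congr hA, hc0, fun x hx _ => heq x hx, ?_,
    horizontal_aux F _ _ K hb hc0 heq⟩
  rw [heq _ hcI, hc0, mul_zero, sub_zero]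
  rfl

end
end
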